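/- arXiv:2202.01005 — 5 statements merged into one kernel-verified Lean document; each statement's English description precedes it below -/
import Mathlib

section
/- Fix γ ∈ (−1,1), let w_* be one of the two domain walls w_*^±, and define the orthonormal frame n_*(x) = −(sin θ_*(x))⁻¹·w_*(x) ∧ (e₁ ∧ w_*(x)) and p_*(x) = (sin θ_*(x))⁻¹·e₁ ∧ w_*(x), and the quadratic form Q(v) = ∫_ℝ (v′² + (1−γ²)(cos²θ_* − sin²θ_*)·v²) dx. There exist δ₃ > 0 and C₃ > 0 such that for every continuously differentiable η : ℝ → ℝ³ with |w_*(x) + η(x)| = 1 for all x, with η₂, η₃, η′ ∈ L² and ‖η‖_{ℋ¹} ≤ δ₃, the scalar functions μ := η·w_*, ν := η·n_*, ρ := η·p_* lie in H¹(ℝ) and satisfy: ‖μ‖_{H¹} ≤ C₃·(‖ν‖_{H¹} + ‖ρ‖_{H¹})²; (1/C₃)·‖η‖_{H¹} ≤ ‖ν‖_{H¹} + ‖ρ‖_{H¹} ≤ C₃·‖η‖_{H¹}; and |E(w_* + η) − E(w_*) − (1/2)(Q(ν) + Q(ρ))| ≤ C₃·(‖ν‖_{H¹} + ‖ρ‖_{H¹})³.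 -/
open MeasureTheory Filter ENNReal

noncomputable section

abbrev E3 := EuclideanSpace ℝ (Fin 3)

/-- canonical basis vectors of ℝ³ -/
def e1 : E3 := !₂[1, 0, 0]
def e2 : E3 := !₂[0, 1, 0]
def e3 : E3 := !₂[0, 0, 1]

/-- cross product in ℝ³ -/
def cross3 (a b : E3) : E3 :=
  !₂[a 1 * b 2 - a 2 * b 1, a 2 * b 0 - a 0 * b 2, a 0 * b 1 - a 1 * b 0]

/-- scalar product in ℝ³ -/
def dot3 (a b : E3) : ℝ := a 0 * b 0 + a 1 * b 1 + a 2 * b 2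

/-- θ_*(x) = 2 arctan (exp (−√(1−γ²) x)) -/
def thetaStar (γ x : ℝ) : ℝ := 2 * Real.arctan (Real.exp (-Real.sqrt (1 - γ ^ 2) * x))

/-- φ_*(x) = −γ x -/
def phiStar (γ x : ℝ) : ℝ := -γ * x

/-- the domain walls w_*^± (s = ±1 is the sign) -/
def wStar (γ s x : ℝ) : E3 :=
  !₂[Real.cos (thetaStar γ x),
    s * (Real.sin (thetaStar γ x) * Real.cos (phiStar γ x)),
    s * (Real.sin (thetaStar γ x) * Real.sin (phiStar γ x))]

/-- rotation about the axis e₁ by angle φ -/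
def rot (φ : ℝ) (v : E3) : E3 :=
  !₂[v 0, v 1 * Real.cos φ - v 2 * Real.sin φ, v 1 * Real.sin φ + v 2 * Real.cos φ]

/-- the energy gradient δE(m) = −m″ − 2γ e₁ ∧ m′ + m₂e₂ + m₃e₃ -/
def deltaE (γ : ℝ) (m : ℝ → E3) (x : ℝ) : E3 :=
  -(deriv (deriv m) x) - (2 * γ) • cross3 e1 (deriv m x) + (m x 1) • e2 + (m x 2) • e3

/-- the L² norm of a function on ℝ -/
def L2norm {E : Type*} [NormedAddCommGroup E] (u : ℝ → E) : ℝ :=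
  (eLpNorm u 2 volume).toReal

/-- the H¹ norm ‖u‖_{L²} + ‖u′‖_{L²} -/
def H1norm {E : Type*} [NormedAddCommGroup E] [NormedSpace ℝ E] (u : ℝ → E) : ℝ :=
  L2norm u + L2norm (deriv u)

/-- the ℋ¹ seminorm ‖m₂‖_{L²} + ‖m₃‖_{L²} + ‖m′‖_{L²} -/
def HH1 (m : ℝ → E3) : ℝ :=
  L2norm (fun x => m x 1) + L2norm (fun x => m x 2) + L2norm (deriv m)

/-- the micromagnetic energy E(m) -/
def energy (γ : ℝ) (m : ℝ → E3) : ℝ :=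
  (1 / 2) * ∫ x : ℝ,
    (‖deriv m x‖ ^ 2 + 2 * γ * dot3 (deriv m x) (cross3 e1 (m x)) + (1 - (m x 0) ^ 2))

/-- the frame vector n_* = −(sin θ_*)⁻¹ w_* ∧ (e₁ ∧ w_*) -/
def nStar (γ s x : ℝ) : E3 :=
  -(Real.sin (thetaStar γ x))⁻¹ • cross3 (wStar γ s x) (cross3 e1 (wStar γ s x))

/-- the frame vector p_* = (sin θ_*)⁻¹ e₁ ∧ w_* -/
def pStar (γ s x : ℝ) : E3 :=
  (Real.sin (thetaStar γ x))⁻¹ • cross3 e1 (wStar γ s x)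

/-- the quadratic form Q(v) = ∫ (v′² + (1−γ²)(cos²θ_* − sin²θ_*)v²) dx -/
def Qform (γ : ℝ) (v : ℝ → ℝ) : ℝ :=
  ∫ x : ℝ, ((deriv v x) ^ 2
    + (1 - γ ^ 2) * (Real.cos (thetaStar γ x) ^ 2 - Real.sin (thetaStar γ x) ^ 2) * (v x) ^ 2)

/-- the coordinates μ = η·w_*, ν = η·n_*, ρ = η·p_* of a perturbation η -/
def muE (γ s : ℝ) (η : ℝ → E3) (x : ℝ) : ℝ := dot3 (η x) (wStar γ s x)
def nuE (γ s : ℝ) (η : ℝ → E3) (x : ℝ) : ℝ := dot3 (η x) (nStar γ s x)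
def rhoE (γ s : ℝ) (η : ℝ → E3) (x : ℝ) : ℝ := dot3 (η x) (pStar γ s x)

section L2
variable {E : Type*} [NormedAddCommGroup E]

lemma l2_nonneg (u : ℝ → E) : 0 ≤ L2norm u := ENNReal.toReal_nonneg

lemma l2_sq {u : ℝ → E} (hu : MemLp u 2 volume) : L2norm u ^ 2 = ∫ x, ‖u x‖ ^ 2 := by
  have h := hu.eLpNorm_eq_integral_rpow_norm (by norm_num) (by norm_num)
  have h0 : 0 ≤ ∫ x, ‖u x‖ ^ 2 := integral_nonneg fun x => by positivity
  unfold L2norm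
  rw [h, ENNReal.toReal_ofReal (by positivity)]
  simp only [ENNReal.toReal_ofNat, Real.rpow_two]
  rw [← Real.rpow_natCast, ← Real.rpow_mul h0]
  norm_num

lemma l2_mono {u : ℝ → E} {g : ℝ → ℝ} (hg : MemLp g 2 volume) (h : ∀ x, ‖u x‖ ≤ g x) :
    L2norm u ≤ L2norm g :=
  ENNReal.toReal_mono hg.2.ne (eLpNorm_mono_real h)

lemma l2_norm (u : ℝ → E) : L2norm (fun x => ‖u x‖) = L2norm u := by
  unfold L2norm; rw [eLpNorm_norm]

lemma l2_add {u v : ℝ → E} (hu : MemLp u 2 volume) (hv : MemLp v 2 volume) :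
    L2norm (fun x => u x + v x) ≤ L2norm u + L2norm v := by
  unfold L2norm
  rw [← ENNReal.toReal_add hu.2.ne hv.2.ne]
  exact ENNReal.toReal_mono (ENNReal.add_ne_top.2 ⟨hu.2.ne, hv.2.ne⟩)
    (eLpNorm_add_le hu.1 hv.1 (by norm_num))

lemma l2_mul {c : ℝ} (hc : 0 ≤ c) (u : ℝ → ℝ) :
    L2norm (fun x => c * u x) = c * L2norm u := by
  unfold L2norm
  have := eLpNorm_const_smul c u 2 (volume : Measure ℝ)
  have e : (fun x => c * u x) = c • u := by ext; simp
  rw [e, this, ENNReal.toReal_mul]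
  simp [abs_of_nonneg hc]

lemma l2_le_mul {u : ℝ → E} {g : ℝ → ℝ} {c : ℝ} (hc : 0 ≤ c) (hg : MemLp g 2 volume)
    (h : ∀ x, ‖u x‖ ≤ c * g x) : L2norm u ≤ c * L2norm g := by
  rw [← l2_mul hc]
  exact l2_mono (hg.const_mul c) h

lemma memLp_le {u : ℝ → E} {g : ℝ → ℝ} {c : ℝ} (hg : MemLp g 2 volume) (hu : Continuous u)
    (h : ∀ x, ‖u x‖ ≤ c * g x) : MemLp u 2 volume :=
  (hg.const_mul c).mono' hu.aestronglyMeasurable (Eventually.of_forall h)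
end L2

/-- Sobolev embedding -/
lemma sobolev {v : ℝ → ℝ} (hv : ContDiff ℝ 1 v) (h0 : MemLp v 2 volume)
    (h1 : MemLp (deriv v) 2 volume) (x : ℝ) : |v x| ≤ H1norm v := by
  have hd : ∀ y, HasDerivAt v (deriv v y) y := fun y =>
    (hv.differentiable (by norm_num) y).hasDerivAt
  have hd2 : ∀ y, HasDerivAt (fun y => v y ^ 2) (2 * v y * deriv v y) y := fun y => by
    have := (hd y).fun_pow 2
    refine this.congr_deriv ?_
    norm_num
  have i0 := h0.integrable_sq
  have i1 := h1.integrable_sq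
  have i01 : Integrable (fun y => 2 * v y * deriv v y) := by
    simpa [mul_assoc] using (h0.integrable_mul h1).const_mul 2
  have i0i1 : Integrable (fun y => v y ^ 2 + deriv v y ^ 2) := i0.add i1
  have ht := tendsto_zero_of_hasDerivAt_of_integrableOn_Iic (a := x) (f := fun y => v y ^ 2)
    (fun y _ => hd2 y) i01.integrableOn i0.integrableOn
  have hI := integral_Iic_of_hasDerivAt_of_tendsto' (a := x) (f := fun y => v y ^ 2)
    (fun y _ => hd2 y) i01.integrableOn ht
  have hle : v x ^ 2 ≤ ∫ y, (v y ^ 2 + deriv v y ^ 2) := by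
    have h2 : v x ^ 2 = ∫ y in Set.Iic x, 2 * v y * deriv v y := by rw [hI]; simp
    rw [h2]
    calc _ ≤ ∫ y in Set.Iic x, (v y ^ 2 + deriv v y ^ 2) :=
          integral_mono (i01.integrableOn (s := Set.Iic x)) i0i1.integrableOn fun y => by
            simp only; nlinarith [sq_nonneg (v y - deriv v y)]
      _ ≤ _ := setIntegral_le_integral (i0.add i1) (Eventually.of_forall fun y => by
            simp only [Pi.zero_apply]; positivity)
  rw [integral_add i0 i1] at hle
  have e0 := l2_sq h0
  have e1 := l2_sq h1
  simp only [Real.norm_eq_abs, sq_abs] at e0 e1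
  rw [← e0, ← e1] at hle
  unfold H1norm
  apply abs_le_of_sq_le_sq _ (add_nonneg (l2_nonneg _) (l2_nonneg _))
  nlinarith [l2_nonneg v, l2_nonneg (deriv v), mul_nonneg (l2_nonneg v) (l2_nonneg (deriv v))]

/-- increments are controlled by the L² norm of the derivative -/
lemma increment {v : ℝ → ℝ} (hv : ContDiff ℝ 1 v)
    (h1 : MemLp (deriv v) 2 volume) {R y : ℝ} (hR : 0 < R) (hy : |y| ≤ R) :
    |v y - v 0| ≤ 1 / 8 + 2 * R * L2norm (deriv v) ^ 2 := by
  have hd : ∀ y, HasDerivAt v (deriv v y) y := fun y =>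
    (hv.differentiable (by norm_num) y).hasDerivAt
  have hc : Continuous (deriv v) := hv.continuous_deriv_one
  have hI := intervalIntegral.integral_eq_sub_of_hasDerivAt (a := 0) (b := y)
    (fun z _ => hd z) (hc.intervalIntegrable _ _)
  have i1 := h1.integrable_sq
  have e1 := l2_sq h1
  simp only [Real.norm_eq_abs, sq_abs] at e1
  rw [← hI, ← Real.norm_eq_abs]
  refine (intervalIntegral.norm_integral_le_integral_norm_uIoc).trans ?_
  have hfin : volume (Set.uIoc 0 y) ≠ ⊤ := by
    rw [Set.uIoc]; simp
  have ic : IntegrableOn (fun _ : ℝ => 1 / (8 * R)) (Set.uIoc 0 y) volume :=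
    integrableOn_const hfin
  calc _ ≤ ∫ z in Set.uIoc 0 y, (1 / (8 * R) + 2 * R * deriv v z ^ 2) := by
        apply integral_mono
        · exact (hc.norm.intervalIntegrable 0 y).def'
        · exact ic.add (i1.const_mul _).integrableOn
        · intro z
          simp only [Real.norm_eq_abs]
          have := sq_nonneg (4 * R * |deriv v z| - 1)
          have h3 : |deriv v z| ^ 2 = deriv v z ^ 2 := sq_abs _
          rw [div_add' _ _ _ (by positivity), le_div_iff₀ (by positivity)]
          rw [← h3]; nlinarith [this]
    _ = (∫ z in Set.uIoc 0 y, 1 / (8 * R)) + ∫ z in Set.uIoc 0 y, 2 * R * deriv v z ^ 2 :=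
        integral_add ic (i1.const_mul _).integrableOn
    _ ≤ _ := by
        apply add_le_add
        · rw [setIntegral_const]
          have : volume.real (Set.uIoc 0 y) = |y| := by
            rw [Measure.real, Real.volume_uIoc]; simp
          rw [this, smul_eq_mul]
          rw [mul_one_div, div_le_div_iff₀ (by positivity) (by positivity)]
          linarith
        · rw [e1, ← integral_const_mul]
          exact setIntegral_le_integral (i1.const_mul _) (Eventually.of_forall fun y => by
            simp only [Pi.zero_apply]; positivity)

/-! trigonometry of the wall -/

lemma kap_pos {γ : ℝ} (hγ : -1 < γ ∧ γ < 1) : 0 < √(1 - γ ^ 2) :=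
  Real.sqrt_pos.2 (by nlinarith [hγ.1, hγ.2])

lemma kap_sq {γ : ℝ} (hγ : -1 < γ ∧ γ < 1) : √(1 - γ ^ 2) ^ 2 = 1 - γ ^ 2 :=
  Real.sq_sqrt (by nlinarith [hγ.1, hγ.2])

lemma kap_le (γ : ℝ) : √(1 - γ ^ 2) ≤ 1 := by
  rw [Real.sqrt_le_left (by norm_num)]; nlinarith [sq_nonneg γ]

lemma cosTh (γ x : ℝ) : Real.cos (thetaStar γ x) =
    (1 - Real.exp (-√(1 - γ ^ 2) * x) ^ 2) / (1 + Real.exp (-√(1 - γ ^ 2) * x) ^ 2) := by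
  unfold thetaStar
  rw [Real.cos_two_mul, Real.cos_sq_arctan]
  field_simp
  ring

lemma sinTh (γ x : ℝ) : Real.sin (thetaStar γ x) =
    2 * Real.exp (-√(1 - γ ^ 2) * x) / (1 + Real.exp (-√(1 - γ ^ 2) * x) ^ 2) := by
  unfold thetaStar
  rw [Real.sin_two_mul, Real.sin_arctan, Real.cos_arctan]
  have h : √(1 + Real.exp (-√(1 - γ ^ 2) * x) ^ 2) ^ 2 = 1 + Real.exp (-√(1 - γ ^ 2) * x) ^ 2 :=
    Real.sq_sqrt (by positivity)
  have h0 : 0 < √(1 + Real.exp (-√(1 - γ ^ 2) * x) ^ 2) := by positivity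
  generalize √(1 + Real.exp (-√(1 - γ ^ 2) * x) ^ 2) = q at *
  rw [← h]
  field_simp

lemma sinTh_pos (γ x : ℝ) : 0 < Real.sin (thetaStar γ x) := by
  rw [sinTh]; positivity

lemma theta_deriv (γ x : ℝ) :
    HasDerivAt (thetaStar γ) (-√(1 - γ ^ 2) * Real.sin (thetaStar γ x)) x := by
  have h1 : HasDerivAt (fun x : ℝ => -√(1 - γ ^ 2) * x) (-√(1 - γ ^ 2)) x := by
    simpa using (hasDerivAt_id x).const_mul (-√(1 - γ ^ 2))
  have := (h1.exp.arctan).const_mul 2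
  refine this.congr_deriv ?_
  rw [sinTh]; field_simp

lemma theta_contDiff (γ : ℝ) : ContDiff ℝ 1 (thetaStar γ) := by
  unfold thetaStar
  exact contDiff_const.mul ((contDiff_const.mul contDiff_id).exp.arctan)

lemma cos_deriv (γ x : ℝ) : HasDerivAt (fun x => Real.cos (thetaStar γ x))
    (√(1 - γ ^ 2) * Real.sin (thetaStar γ x) ^ 2) x :=
  (theta_deriv γ x).cos.congr_deriv (by ring)

lemma sin_deriv (γ x : ℝ) : HasDerivAt (fun x => Real.sin (thetaStar γ x))
    (-√(1 - γ ^ 2) * Real.sin (thetaStar γ x) * Real.cos (thetaStar γ x)) x :=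
  (theta_deriv γ x).sin.congr_deriv (by ring)

lemma phi_deriv (γ x : ℝ) : HasDerivAt (phiStar γ) (-γ) x := by
  refine ((hasDerivAt_id x).const_mul (-γ)).congr_deriv ?_
  simp

lemma cosφ_deriv (γ x : ℝ) : HasDerivAt (fun x => Real.cos (phiStar γ x))
    (γ * Real.sin (phiStar γ x)) x :=
  (phi_deriv γ x).cos.congr_deriv (by ring)

lemma sinφ_deriv (γ x : ℝ) : HasDerivAt (fun x => Real.sin (phiStar γ x))
    (-γ * Real.cos (phiStar γ x)) x :=
  (phi_deriv γ x).sin.congr_deriv (by ring)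

lemma cos_zero (γ : ℝ) : Real.cos (thetaStar γ 0) = 0 := by
  rw [cosTh]; simp

lemma cos_far {γ : ℝ} (hγ : -1 < γ ∧ γ < 1) {x : ℝ} (hx : 1 / √(1 - γ ^ 2) ≤ |x|) :
    1 / 2 ≤ |Real.cos (thetaStar γ x)| := by
  have hk := kap_pos hγ
  rw [cosTh]
  set k := √(1 - γ ^ 2)
  have hx' : 1 ≤ k * |x| := by
    rw [div_le_iff₀ hk] at hx; linarith
  have hden : 0 < 1 + Real.exp (-k * x) ^ 2 := by positivity
  rw [abs_div, abs_of_pos hden, le_div_iff₀ hden]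
  rcases le_total 0 x with h | h
  · rw [abs_of_nonneg h] at hx'
    have h1 := Real.add_one_le_exp (k * x)
    have h2 : Real.exp (-k * x) * Real.exp (k * x) = 1 := by
      rw [← Real.exp_add]; simp
    have h3 : Real.exp (-k * x) ≤ 1 / 2 := by
      nlinarith [Real.exp_pos (-k * x)]
    have h4 := Real.exp_pos (-k * x)
    refine le_trans ?_ (le_abs_self _)
    nlinarith
  · rw [abs_of_nonpos h] at hx'
    have h1 := Real.add_one_le_exp (-k * x)
    refine le_trans ?_ (neg_le_abs _)
    nlinarith

lemma sin_memLp {γ : ℝ} (hγ : -1 < γ ∧ γ < 1) :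
    MemLp (fun x => Real.sin (thetaStar γ x)) 2 volume := by
  have hk := kap_pos hγ
  have hc : Continuous (fun x => Real.sin (thetaStar γ x)) :=
    Real.continuous_sin.comp (theta_contDiff γ).continuous
  rw [memLp_two_iff_integrable_sq hc.aestronglyMeasurable]
  refine Integrable.mono' (g := fun x => (1 + (√(1 - γ ^ 2) * x) ^ 2)⁻¹)
    (integrable_inv_one_add_sq.comp_mul_left' hk.ne') (hc.pow 2).aestronglyMeasurable
    (Eventually.of_forall fun x => ?_)
  rw [Real.norm_eq_abs, abs_of_nonneg (by positivity), sinTh]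
  set k := √(1 - γ ^ 2)
  have h4 := Real.exp_pos (-k * x)
  have h2 : Real.exp (-k * x) * Real.exp (k * x) = 1 := by
    rw [← Real.exp_add]; simp
  have h5 : |k * x| ≤ |Real.sinh (k * x)| := by
    rw [Real.abs_sinh, Real.self_le_sinh_iff]; positivity
  have h6 : (k * x) ^ 2 ≤ Real.sinh (k * x) ^ 2 := sq_le_sq.2 h5
  rw [Real.sinh_eq] at h6
  have e : -(k * x) = -k * x := by ring
  rw [e] at h6
  set t := Real.exp (-k * x)
  set u := Real.exp (k * x)
  rw [le_inv_comm₀ (by positivity) (by positivity)]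
  have : ((2 * t / (1 + t ^ 2)) ^ 2)⁻¹ = 1 + ((u - t) / 2) ^ 2 := by
    have hu : u = 1 / t := by field_simp; linarith
    rw [hu]; field_simp; ring
  rw [this]; linarith
lemma nStar_eq (γ s x : ℝ) (hs : s ^ 2 = 1) : nStar γ s x =
    !₂[-Real.sin (thetaStar γ x), s * Real.cos (thetaStar γ x) * Real.cos (phiStar γ x),
      s * Real.cos (thetaStar γ x) * Real.sin (phiStar γ x)] := by
  have h := (sinTh_pos γ x).ne'
  have h2 := Real.sin_sq_add_cos_sq (phiStar γ x)
  unfold nStar cross3 e1 wStar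
  ext i
  fin_cases i <;> simp
  · field_simp
    linear_combination s ^ 2 * h2 + hs
  · field_simp
  · field_simp

lemma pStar_eq (γ s x : ℝ) : pStar γ s x =
    !₂[0, -(s * Real.sin (phiStar γ x)), s * Real.cos (phiStar γ x)] := by
  have h := (sinTh_pos γ x).ne'
  unfold pStar cross3 e1 wStar
  ext i
  fin_cases i <;> simp
  · field_simp
  · field_simp

section coords
variable (γ s : ℝ) (η : ℝ → E3) (x : ℝ)

/-- rotated tangential component -/
def bE : ℝ := s * (η x 1 * Real.cos (phiStar γ x) + η x 2 * Real.sin (phiStar γ x))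
def pE : ℝ := s * (deriv η x 1 * Real.cos (phiStar γ x) + deriv η x 2 * Real.sin (phiStar γ x))
def qE : ℝ := s * (deriv η x 2 * Real.cos (phiStar γ x) - deriv η x 1 * Real.sin (phiStar γ x))

lemma muE_eq : muE γ s η x =
    Real.cos (thetaStar γ x) * η x 0 + Real.sin (thetaStar γ x) * bE γ s η x := by
  unfold muE dot3 wStar bE; simp; ring

lemma nuE_eq (hs : s ^ 2 = 1) : nuE γ s η x =
    -Real.sin (thetaStar γ x) * η x 0 + Real.cos (thetaStar γ x) * bE γ s η x := by
  unfold nuE dot3 bE; rw [nStar_eq γ s x hs]; simp; ring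

lemma rhoE_eq : rhoE γ s η x =
    s * (η x 2 * Real.cos (phiStar γ x) - η x 1 * Real.sin (phiStar γ x)) := by
  unfold rhoE dot3; rw [pStar_eq γ s x]; simp; ring

lemma comp_deriv {η : ℝ → E3} (hη : ContDiff ℝ 1 η) (i : Fin 3) (x : ℝ) :
    HasDerivAt (fun y => η y i) (deriv η x i) x := by
  have h := (hη.differentiable (by norm_num) x).hasDerivAt
  exact ((EuclideanSpace.proj i : E3 →L[ℝ] ℝ).hasFDerivAt.comp_hasDerivAt x h)

lemma bE_deriv {η : ℝ → E3} (hη : ContDiff ℝ 1 η) :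
    HasDerivAt (bE γ s η) (pE γ s η x - γ * rhoE γ s η x) x := by
  have h := (((comp_deriv hη 1 x).mul (cosφ_deriv γ x)).add
    ((comp_deriv hη 2 x).mul (sinφ_deriv γ x))).const_mul s
  refine h.congr_deriv ?_
  rw [rhoE_eq, pE]; ring

lemma muE_deriv (hs : s ^ 2 = 1) {η : ℝ → E3} (hη : ContDiff ℝ 1 η) :
    HasDerivAt (muE γ s η) (Real.cos (thetaStar γ x) * deriv η x 0
      + Real.sin (thetaStar γ x) * (pE γ s η x - γ * rhoE γ s η x)
      - √(1 - γ ^ 2) * Real.sin (thetaStar γ x) * nuE γ s η x) x := by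
  have h := ((cos_deriv γ x).mul (comp_deriv hη 0 x)).add
    ((sin_deriv γ x).mul (bE_deriv γ s x hη))
  have e : muE γ s η = _ := funext (muE_eq γ s η)
  rw [e]
  refine h.congr_deriv ?_
  rw [nuE_eq _ _ _ _ hs]; ring

lemma nuE_deriv (hs : s ^ 2 = 1) {η : ℝ → E3} (hη : ContDiff ℝ 1 η) :
    HasDerivAt (nuE γ s η) (-Real.sin (thetaStar γ x) * deriv η x 0
      + Real.cos (thetaStar γ x) * (pE γ s η x - γ * rhoE γ s η x)
      + √(1 - γ ^ 2) * Real.sin (thetaStar γ x) * muE γ s η x) x := by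
  have h := ((sin_deriv γ x).neg.mul (comp_deriv hη 0 x)).add
    ((cos_deriv γ x).mul (bE_deriv γ s x hη))
  have e : nuE γ s η = _ := funext fun x => nuE_eq γ s η x hs
  rw [e]
  refine h.congr_deriv ?_
  rw [muE_eq]; simp only [Pi.neg_apply]; ring

lemma rhoE_deriv {η : ℝ → E3} (hη : ContDiff ℝ 1 η) :
    HasDerivAt (rhoE γ s η) (qE γ s η x + γ * bE γ s η x) x := by
  have h := (((comp_deriv hη 2 x).mul (cosφ_deriv γ x)).sub
    ((comp_deriv hη 1 x).mul (sinφ_deriv γ x))).const_mul s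
  have e : rhoE γ s η = _ := funext (rhoE_eq γ s η)
  rw [e]
  refine h.congr_deriv ?_
  rw [qE, bE]; ring

lemma cosθ_cd (γ : ℝ) : ContDiff ℝ 1 (fun x => Real.cos (thetaStar γ x)) :=
  (theta_contDiff γ).cos
lemma sinθ_cd (γ : ℝ) : ContDiff ℝ 1 (fun x => Real.sin (thetaStar γ x)) :=
  (theta_contDiff γ).sin
lemma cosφ_cd (γ : ℝ) : ContDiff ℝ 1 (fun x => Real.cos (phiStar γ x)) := by
  unfold phiStar; fun_prop
lemma sinφ_cd (γ : ℝ) : ContDiff ℝ 1 (fun x => Real.sin (phiStar γ x)) := by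
  unfold phiStar; fun_prop

lemma comp_cd {η : ℝ → E3} (hη : ContDiff ℝ 1 η) (i : Fin 3) : ContDiff ℝ 1 (fun x => η x i) :=
  contDiff_euclidean.1 hη i

lemma bE_cd {η : ℝ → E3} (hη : ContDiff ℝ 1 η) : ContDiff ℝ 1 (bE γ s η) :=
  contDiff_const.mul (((comp_cd hη 1).mul (cosφ_cd γ)).add ((comp_cd hη 2).mul (sinφ_cd γ)))

lemma muE_cd {η : ℝ → E3} (hη : ContDiff ℝ 1 η) : ContDiff ℝ 1 (muE γ s η) := by
  have e : muE γ s η = _ := funext (muE_eq γ s η)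
  rw [e]
  exact ((cosθ_cd γ).mul (comp_cd hη 0)).add ((sinθ_cd γ).mul (bE_cd γ s hη))

lemma nuE_cd (hs : s ^ 2 = 1) {η : ℝ → E3} (hη : ContDiff ℝ 1 η) : ContDiff ℝ 1 (nuE γ s η) := by
  have e : nuE γ s η = _ := funext fun x => nuE_eq γ s η x hs
  rw [e]
  exact ((sinθ_cd γ).neg.mul (comp_cd hη 0)).add ((cosθ_cd γ).mul (bE_cd γ s hη))

lemma rhoE_cd {η : ℝ → E3} (hη : ContDiff ℝ 1 η) : ContDiff ℝ 1 (rhoE γ s η) := by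
  have e : rhoE γ s η = _ := funext (rhoE_eq γ s η)
  rw [e]
  exact contDiff_const.mul (((comp_cd hη 2).mul (cosφ_cd γ)).sub ((comp_cd hη 1).mul (sinφ_cd γ)))

lemma wStar_cd : ContDiff ℝ 1 (wStar γ s) := by
  rw [contDiff_euclidean]
  intro i
  fin_cases i
  · exact cosθ_cd γ
  · exact contDiff_const.mul ((sinθ_cd γ).mul (cosφ_cd γ))
  · exact contDiff_const.mul ((sinθ_cd γ).mul (sinφ_cd γ))

lemma wStar_deriv0 : deriv (wStar γ s) x 0 = √(1 - γ ^ 2) * Real.sin (thetaStar γ x) ^ 2 :=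
  (comp_deriv (wStar_cd γ s) 0 x).unique (cos_deriv γ x)

lemma wStar_deriv1 : deriv (wStar γ s) x 1 =
    s * (-√(1 - γ ^ 2) * Real.sin (thetaStar γ x) * Real.cos (thetaStar γ x)
      * Real.cos (phiStar γ x) + Real.sin (thetaStar γ x) * (γ * Real.sin (phiStar γ x))) :=
  (comp_deriv (wStar_cd γ s) 1 x).unique (((sin_deriv γ x).mul (cosφ_deriv γ x)).const_mul s)

lemma wStar_deriv2 : deriv (wStar γ s) x 2 =
    s * (-√(1 - γ ^ 2) * Real.sin (thetaStar γ x) * Real.cos (thetaStar γ x)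
      * Real.sin (phiStar γ x) + Real.sin (thetaStar γ x) * (-γ * Real.cos (phiStar γ x))) :=
  (comp_deriv (wStar_cd γ s) 2 x).unique (((sin_deriv γ x).mul (sinφ_deriv γ x)).const_mul s)

lemma comp1 (hs : s ^ 2 = 1) : η x 1 =
    s * (bE γ s η x * Real.cos (phiStar γ x) - rhoE γ s η x * Real.sin (phiStar γ x)) := by
  have h2 := Real.sin_sq_add_cos_sq (phiStar γ x)
  rw [rhoE_eq, bE]
  linear_combination (-η x 1) * hs - s ^ 2 * η x 1 * h2

lemma comp2 (hs : s ^ 2 = 1) : η x 2 =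
    s * (bE γ s η x * Real.sin (phiStar γ x) + rhoE γ s η x * Real.cos (phiStar γ x)) := by
  have h2 := Real.sin_sq_add_cos_sq (phiStar γ x)
  rw [rhoE_eq, bE]
  linear_combination (-η x 2) * hs - s ^ 2 * η x 2 * h2

lemma dcomp1 (hs : s ^ 2 = 1) : deriv η x 1 =
    s * (pE γ s η x * Real.cos (phiStar γ x) - qE γ s η x * Real.sin (phiStar γ x)) := by
  have h2 := Real.sin_sq_add_cos_sq (phiStar γ x)
  rw [pE, qE]
  linear_combination (-deriv η x 1) * hs - s ^ 2 * deriv η x 1 * h2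

lemma dcomp2 (hs : s ^ 2 = 1) : deriv η x 2 =
    s * (pE γ s η x * Real.sin (phiStar γ x) + qE γ s η x * Real.cos (phiStar γ x)) := by
  have h2 := Real.sin_sq_add_cos_sq (phiStar γ x)
  rw [pE, qE]
  linear_combination (-deriv η x 2) * hs - s ^ 2 * deriv η x 2 * h2

lemma norm_sq3 (v : E3) : ‖v‖ ^ 2 = v 0 ^ 2 + v 1 ^ 2 + v 2 ^ 2 := by
  rw [EuclideanSpace.real_norm_sq_eq, Fin.sum_univ_three]

lemma rot_sq {s C S : ℝ} (hs : s ^ 2 = 1) (h : S ^ 2 + C ^ 2 = 1) (p q : ℝ) :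
    (s * (p * C - q * S)) ^ 2 + (s * (p * S + q * C)) ^ 2 = p ^ 2 + q ^ 2 := by
  linear_combination (p ^ 2 + q ^ 2) * hs + s ^ 2 * (p ^ 2 + q ^ 2) * h

lemma rot_cross {s C S : ℝ} (hs : s ^ 2 = 1) (h : S ^ 2 + C ^ 2 = 1) (p q p' q' : ℝ) :
    (s * (p * S + q * C)) * (s * (p' * C - q' * S)) - (s * (p * C - q * S)) * (s * (p' * S + q' * C))
     = q * p' - p * q' := by
  linear_combination (q * p' - p * q') * hs + s ^ 2 * (q * p' - p * q') * h

lemma norm_eta (hs : s ^ 2 = 1) :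
    ‖η x‖ ^ 2 = η x 0 ^ 2 + bE γ s η x ^ 2 + rhoE γ s η x ^ 2 := by
  rw [norm_sq3, comp1 γ s η x hs, comp2 γ s η x hs]
  linear_combination rot_sq hs (Real.sin_sq_add_cos_sq (phiStar γ x)) (bE γ s η x) (rhoE γ s η x)

lemma norm_deta (hs : s ^ 2 = 1) :
    ‖deriv η x‖ ^ 2 = deriv η x 0 ^ 2 + pE γ s η x ^ 2 + qE γ s η x ^ 2 := by
  rw [norm_sq3, dcomp1 γ s η x hs, dcomp2 γ s η x hs]
  linear_combination rot_sq hs (Real.sin_sq_add_cos_sq (phiStar γ x)) (pE γ s η x) (qE γ s η x)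

lemma norm_eta' (hs : s ^ 2 = 1) :
    ‖η x‖ ^ 2 = muE γ s η x ^ 2 + nuE γ s η x ^ 2 + rhoE γ s η x ^ 2 := by
  rw [norm_eta γ s η x hs, muE_eq, nuE_eq _ _ _ _ hs]
  linear_combination (-(η x 0) ^ 2 - bE γ s η x ^ 2) * Real.sin_sq_add_cos_sq (thetaStar γ x)

lemma norm_m (hs : s ^ 2 = 1) : ‖wStar γ s x + η x‖ ^ 2 = (Real.cos (thetaStar γ x) + η x 0) ^ 2
    + (Real.sin (thetaStar γ x) + bE γ s η x) ^ 2 + rhoE γ s η x ^ 2 := by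
  rw [norm_sq3]
  have := rot_sq hs (Real.sin_sq_add_cos_sq (phiStar γ x))
    (Real.sin (thetaStar γ x) + bE γ s η x) (rhoE γ s η x)
  simp only [PiLp.add_apply]
  rw [comp1 γ s η x hs, comp2 γ s η x hs]
  simp only [wStar]
  simp
  linear_combination this

lemma constraint (hs : s ^ 2 = 1) (h : ‖wStar γ s x + η x‖ = 1) :
    2 * muE γ s η x + (muE γ s η x ^ 2 + nuE γ s η x ^ 2 + rhoE γ s η x ^ 2) = 0 := by
  have h1 := norm_m γ s η x hs
  rw [h] at h1
  rw [← norm_eta' γ s η x hs, norm_eta γ s η x hs, muE_eq]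
  linear_combination -h1 - Real.sin_sq_add_cos_sq (thetaStar γ x)

/-- the remainder density -/
def remE : ℝ := deriv (muE γ s η) x ^ 2
  + 2 * √(1 - γ ^ 2) * Real.sin (thetaStar γ x)
    * (nuE γ s η x * deriv (muE γ s η) x - muE γ s η x * deriv (nuE γ s η) x)
  + 2 * √(1 - γ ^ 2) ^ 2 * Real.cos (thetaStar γ x) * Real.sin (thetaStar γ x)
    * muE γ s η x * nuE γ s η x

lemma density (hγ : -1 < γ ∧ γ < 1) (hs : s ^ 2 = 1) {η : ℝ → E3} (hη : ContDiff ℝ 1 η)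
    (h : ‖wStar γ s x + η x‖ = 1) :
    ‖deriv (fun x => wStar γ s x + η x) x‖ ^ 2
      + 2 * γ * dot3 (deriv (fun x => wStar γ s x + η x) x) (cross3 e1 (wStar γ s x + η x))
      + (1 - ((wStar γ s x + η x) 0) ^ 2)
    = 2 * (1 - γ ^ 2) * Real.sin (thetaStar γ x) ^ 2
      + (deriv (nuE γ s η) x ^ 2 + (1 - γ ^ 2) *
          (Real.cos (thetaStar γ x) ^ 2 - Real.sin (thetaStar γ x) ^ 2) * nuE γ s η x ^ 2)
      + (deriv (rhoE γ s η) x ^ 2 + (1 - γ ^ 2) *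
          (Real.cos (thetaStar γ x) ^ 2 - Real.sin (thetaStar γ x) ^ 2) * rhoE γ s η x ^ 2)
      - 2 * √(1 - γ ^ 2) * (-√(1 - γ ^ 2) * Real.sin (thetaStar γ x) * Real.cos (thetaStar γ x)
          * nuE γ s η x + Real.sin (thetaStar γ x) * deriv (nuE γ s η) x)
      + remE γ s η x := by
  have hk := kap_sq hγ
  have hd : deriv (fun x => wStar γ s x + η x) x = deriv (wStar γ s) x + deriv η x :=
    deriv_fun_add ((wStar_cd γ s).differentiable (by norm_num) x)
      (hη.differentiable (by norm_num) x)
  have h1 := norm_m γ s η x hs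
  rw [h] at h1
  have hc := constraint γ s η x hs h
  have hφ := Real.sin_sq_add_cos_sq (phiStar γ x)
  have hθ := Real.sin_sq_add_cos_sq (thetaStar γ x)
  have r1 := rot_sq hs hφ
    (-√(1 - γ ^ 2) * Real.sin (thetaStar γ x) * Real.cos (thetaStar γ x) + pE γ s η x)
    (qE γ s η x - γ * Real.sin (thetaStar γ x))
  have r2 := rot_cross hs hφ
    (-√(1 - γ ^ 2) * Real.sin (thetaStar γ x) * Real.cos (thetaStar γ x) + pE γ s η x)
    (qE γ s η x - γ * Real.sin (thetaStar γ x))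
    (Real.sin (thetaStar γ x) + bE γ s η x) (rhoE γ s η x)
  -- the density in rotated variables
  have s1 : ‖deriv (fun x => wStar γ s x + η x) x‖ ^ 2
      + 2 * γ * dot3 (deriv (fun x => wStar γ s x + η x) x) (cross3 e1 (wStar γ s x + η x))
      + (1 - ((wStar γ s x + η x) 0) ^ 2) =
      (√(1 - γ ^ 2) * Real.sin (thetaStar γ x) ^ 2 + deriv η x 0) ^ 2
      + ((-√(1 - γ ^ 2) * Real.sin (thetaStar γ x) * Real.cos (thetaStar γ x) + pE γ s η x) ^ 2
        + (qE γ s η x - γ * Real.sin (thetaStar γ x)) ^ 2)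
      + 2 * γ * ((qE γ s η x - γ * Real.sin (thetaStar γ x))
          * (Real.sin (thetaStar γ x) + bE γ s η x)
        - (-√(1 - γ ^ 2) * Real.sin (thetaStar γ x) * Real.cos (thetaStar γ x) + pE γ s η x)
          * rhoE γ s η x)
      + (1 - (Real.cos (thetaStar γ x) + η x 0) ^ 2) := by
    rw [← r1, ← r2, hd, norm_sq3]
    simp only [dot3, cross3, e1, PiLp.add_apply, wStar_deriv0, wStar_deriv1, wStar_deriv2]
    rw [dcomp1 γ s η x hs, dcomp2 γ s η x hs, comp1 γ s η x hs, comp2 γ s η x hs]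
    simp [wStar]
    ring
  rw [s1]
  have dm := (muE_deriv γ s x hs hη).deriv
  have dn := (nuE_deriv γ s x hs hη).deriv
  have dr := (rhoE_deriv γ s x hη).deriv
  have em := muE_eq γ s η x
  have en := nuE_eq γ s η x hs
  unfold remE
  generalize deriv (muE γ s η) x = m' at *
  generalize deriv (nuE γ s η) x = n' at *
  generalize deriv (rhoE γ s η) x = r' at *
  generalize muE γ s η x = m at *
  generalize nuE γ s η x = n at *
  generalize rhoE γ s η x = r at *
  generalize pE γ s η x = P at *
  generalize qE γ s η x = Q at *
  generalize bE γ s η x = B at *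
  generalize deriv η x 0 = a' at *
  generalize η x 0 = a at *
  generalize Real.cos (thetaStar γ x) = c at *
  generalize Real.sin (thetaStar γ x) = σ at *
  generalize √(1 - γ ^ 2) = k at *
  clear r1 r2 s1 hd hφ h
  have ea : a = c * m - σ * n := by
    rw [em, en]; linear_combination -a * hθ
  have eB : B = σ * m + c * n := by
    rw [em, en]; linear_combination -B * hθ
  have ea' : a' = c * (m' + k * σ * n) - σ * (n' - k * σ * m) := by
    rw [dm, dn]; linear_combination -a' * hθ
  have eP : P = σ * (m' + k * σ * n) + c * (n' - k * σ * m) + γ * r := by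
    rw [dm, dn]; linear_combination (-P + γ * r) * hθ
  have eQ : Q = r' - γ * B := by rw [dr]; ring
  have t1 : (k * σ ^ 2 + a') ^ 2 + ((-k * σ * c + P) ^ 2 + (Q - γ * σ) ^ 2)
      + 2 * γ * ((Q - γ * σ) * (σ + B) - (-k * σ * c + P) * r) + (1 - (c + a) ^ 2)
      = (k * σ ^ 2 + a') ^ 2 + (P - γ * r - k * σ * c) ^ 2 + r' ^ 2
        + k ^ 2 * (1 - (c + a) ^ 2) := by
    rw [eQ, hk]
    linear_combination (γ ^ 2) * h1
  have t2 : (k * σ ^ 2 + a') ^ 2 + (P - γ * r - k * σ * c) ^ 2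
      = (m' + k * σ * n) ^ 2 + (n' - k * σ * (1 + m)) ^ 2 := by
    have u1 : c * (k * σ ^ 2 + a') + σ * (P - γ * r - k * σ * c) = m' + k * σ * n := by
      rw [ea', eP]; linear_combination (m' + k * σ * n) * hθ
    have u2 : -σ * (k * σ ^ 2 + a') + c * (P - γ * r - k * σ * c) = n' - k * σ * (1 + m) := by
      rw [ea', eP]; linear_combination (n' - k * σ * (1 + m)) * hθ
    rw [← u1, ← u2]
    linear_combination (-((k * σ ^ 2 + a') ^ 2 + (P - γ * r - k * σ * c) ^ 2)) * hθ
  have t3 : c + a = c * (1 + m) - σ * n := by rw [ea]; ring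
  rw [t1, t2, t3, ← hk]
  linear_combination (-k ^ 2) * hθ + k ^ 2 * (σ ^ 2 - c ^ 2) * hc
end coords
lemma comp_le (v : E3) (i : Fin 3) : |v i| ≤ ‖v‖ := by
  simpa using PiLp.norm_apply_le v i

lemma w_comp (γ s x : ℝ) (hs : s ^ 2 = 1) : |wStar γ s x 1| ≤ 1 ∧ |wStar γ s x 2| ≤ 1 ∧
    wStar γ s x 0 ^ 2 + wStar γ s x 1 ^ 2 + wStar γ s x 2 ^ 2 = 1 := by
  have h1 := Real.sin_sq_add_cos_sq (phiStar γ x)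
  have h2 := Real.sin_sq_add_cos_sq (thetaStar γ x)
  have h3 : wStar γ s x 0 ^ 2 + wStar γ s x 1 ^ 2 + wStar γ s x 2 ^ 2 = 1 := by
    simp [wStar]
    linear_combination h2 + Real.sin (thetaStar γ x) ^ 2 * h1 +
      Real.sin (thetaStar γ x) ^ 2 * (Real.sin (phiStar γ x) ^ 2 + Real.cos (phiStar γ x) ^ 2) * hs
  refine ⟨?_, ?_, h3⟩ <;>
  · apply abs_le_of_sq_le_sq _ zero_le_one
    nlinarith [sq_nonneg (wStar γ s x 0), sq_nonneg (wStar γ s x 1), sq_nonneg (wStar γ s x 2)]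

lemma small {γ : ℝ} (hγ : -1 < γ ∧ γ < 1) {s : ℝ} (hs : s ^ 2 = 1) {η : ℝ → E3}
    (hη : ContDiff ℝ 1 η) (hn : ∀ x, ‖wStar γ s x + η x‖ = 1)
    (h1 : MemLp (fun x => η x 1) 2 volume) (h2 : MemLp (fun x => η x 2) 2 volume)
    (hd : MemLp (deriv η) 2 volume) (hδ : HH1 η ≤ √(1 - γ ^ 2) / 1000) :
    (∀ x, ‖η x‖ ≤ 1) ∧ MemLp η 2 volume := by
  have hk := kap_pos hγ
  have hk1 := kap_le γ
  have hdi : ∀ i, deriv (fun x => η x i) = fun x => deriv η x i := fun i =>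
    funext fun x => (comp_deriv hη i x).deriv
  have hdc : Continuous (deriv η) := hη.continuous_deriv_one
  have hdm : ∀ i, MemLp (deriv (fun x => η x i)) 2 volume := fun i => by
    rw [hdi]
    exact memLp_le (c := 1) hd.norm ((EuclideanSpace.proj i : E3 →L[ℝ] ℝ).continuous.comp hdc)
      fun x => by simpa using comp_le (deriv η x) i
  have hdl : ∀ i, L2norm (deriv (fun x => η x i)) ≤ L2norm (deriv η) := fun i => by
    rw [hdi, ← l2_norm (deriv η)]
    exact l2_mono hd.norm fun x => comp_le (deriv η x) i
  unfold HH1 at hδ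
  have n1 := l2_nonneg (fun x => η x 1)
  have n2 := l2_nonneg (fun x => η x 2)
  have n3 := l2_nonneg (deriv η)
  have b1 : ∀ x, |η x 1| ≤ 1 / 1000 := fun x => by
    have := sobolev (comp_cd hη 1) h1 (hdm 1) x
    unfold H1norm at this
    linarith [hdl 1]
  have b2 : ∀ x, |η x 2| ≤ 1 / 1000 := fun x => by
    have := sobolev (comp_cd hη 2) h2 (hdm 2) x
    unfold H1norm at this
    linarith [hdl 2]
  have key : ∀ x, |η x 0| * |2 * Real.cos (thetaStar γ x) + η x 0| ≤
      3 * |η x 1| + 3 * |η x 2| := fun x => by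
    obtain ⟨w1, w2, w3⟩ := w_comp γ s x hs
    have h := norm_sq3 (wStar γ s x + η x)
    rw [hn x] at h
    simp only [PiLp.add_apply] at h
    have w0 : wStar γ s x 0 = Real.cos (thetaStar γ x) := rfl
    rw [← abs_mul, ← w0]
    have e : η x 0 * (2 * wStar γ s x 0 + η x 0) =
        -(η x 1 * (2 * wStar γ s x 1 + η x 1)) - (η x 2 * (2 * wStar γ s x 2 + η x 2)) := by
      linear_combination -h - w3
    rw [e]
    have c1 : |η x 1 * (2 * wStar γ s x 1 + η x 1)| ≤ |η x 1| * 3 := by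
      rw [abs_mul]
      refine mul_le_mul_of_nonneg_left ?_ (abs_nonneg _)
      refine (abs_add_le _ _).trans ?_
      rw [abs_mul, abs_two]; linarith [b1 x]
    have c2 : |η x 2 * (2 * wStar γ s x 2 + η x 2)| ≤ |η x 2| * 3 := by
      rw [abs_mul]
      refine mul_le_mul_of_nonneg_left ?_ (abs_nonneg _)
      refine (abs_add_le _ _).trans ?_
      rw [abs_mul, abs_two]; linarith [b2 x]
    refine (abs_sub _ _).trans ?_
    rw [abs_neg]; linarith
  have z0 : |η 0 0| ≤ 1 / 10 := by
    have := key 0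
    rw [cos_zero] at this
    simp only [mul_zero, zero_add] at this
    nlinarith [b1 0, b2 0, abs_nonneg (η 0 0)]
  have near : ∀ x, |x| ≤ 1 / √(1 - γ ^ 2) → |η x 0| < 1 / 2 := fun x hx => by
    have h := increment (comp_cd hη 0) (hdm 0) (by positivity) hx
    have l : L2norm (deriv (fun x => η x 0)) ≤ √(1 - γ ^ 2) / 1000 := by linarith [hdl 0]
    have l0 := l2_nonneg (deriv (fun x => η x 0))
    have l2 : L2norm (deriv (fun x => η x 0)) ^ 2 ≤ (√(1 - γ ^ 2) / 1000) ^ 2 :=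
      pow_le_pow_left₀ l0 l 2
    have l3 : 2 * (1 / √(1 - γ ^ 2)) * L2norm (deriv (fun x => η x 0)) ^ 2
        ≤ 2 * (1 / √(1 - γ ^ 2)) * (√(1 - γ ^ 2) / 1000) ^ 2 :=
      mul_le_mul_of_nonneg_left l2 (by positivity)
    have l4 : 2 * (1 / √(1 - γ ^ 2)) * (√(1 - γ ^ 2) / 1000) ^ 2 = 2 * √(1 - γ ^ 2) / 1000000 := by
      field_simp; norm_num
    have := abs_sub_abs_le_abs_sub (η x 0) (η 0 0)
    linarith
  have nohalf : ∀ x, |η x 0| ≠ 1 / 2 := fun x hx => by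
    rcases le_total |x| (1 / √(1 - γ ^ 2)) with h | h
    · exact (near x h).ne hx
    · have h3 := cos_far hγ h
      have h4 := key x
      have h5 : 1 / 2 ≤ |2 * Real.cos (thetaStar γ x) + η x 0| := by
        have := abs_sub_abs_le_abs_sub (2 * Real.cos (thetaStar γ x)) (-η x 0)
        rw [abs_neg, abs_mul, abs_two, sub_neg_eq_add] at this
        linarith
      rw [hx] at h4
      linarith [b1 x, b2 x]
  have hc0 : Continuous (fun x => |η x 0|) := (comp_cd hη 0).continuous.abs
  have b0 : ∀ x, |η x 0| ≤ 1 / 2 := fun x => by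
    by_contra hx
    push Not at hx
    have := mem_range_of_exists_le_of_exists_ge hc0 (c := 1 / 2) ⟨0, by linarith⟩ ⟨x, hx.le⟩
    obtain ⟨y, hy⟩ := this
    exact nohalf y hy
  constructor
  · intro x
    have := norm_sq3 (η x)
    have q0 := abs_le.1 (b0 x)
    have q1 := abs_le.1 (b1 x)
    have q2 := abs_le.1 (b2 x)
    refine (sq_le_one_iff₀ (norm_nonneg _)).1 ?_
    nlinarith
  · have hi : MemLp ((Set.Icc (-(1 / √(1 - γ ^ 2))) (1 / √(1 - γ ^ 2))).indicator
        (fun _ => (1 : ℝ))) 2 volume :=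
      memLp_indicator_const 2 measurableSet_Icc 1 (Or.inr (by simp))
    have hg : MemLp (fun x => |η x 1| + |η x 2| +
        (Set.Icc (-(1 / √(1 - γ ^ 2))) (1 / √(1 - γ ^ 2))).indicator (fun _ => (1 : ℝ)) x)
        2 volume := (h1.norm.add h2.norm).add hi
    refine memLp_le (c := 10) hg hη.continuous fun x => ?_
    have h0 : |η x 0| ≤ 6 * |η x 1| + 6 * |η x 2| +
        (Set.Icc (-(1 / √(1 - γ ^ 2))) (1 / √(1 - γ ^ 2))).indicator (fun _ => (1 : ℝ)) x := by
      by_cases hx : |x| ≤ 1 / √(1 - γ ^ 2)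
      · rw [Set.indicator_of_mem (by exact abs_le.1 hx)]
        linarith [b0 x, abs_nonneg (η x 1), abs_nonneg (η x 2)]
      · rw [Set.indicator_of_notMem (fun h : x ∈ Set.Icc _ _ => hx (abs_le.2 h))]
        have h3 := cos_far hγ (not_le.1 hx).le
        have h4 := key x
        have h5 : 1 / 2 ≤ |2 * Real.cos (thetaStar γ x) + η x 0| := by
          have := abs_sub_abs_le_abs_sub (2 * Real.cos (thetaStar γ x)) (-η x 0)
          rw [abs_neg, abs_mul, abs_two, sub_neg_eq_add] at this
          linarith [b0 x]
        nlinarith [abs_nonneg (η x 0)]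
    have hnorm : ‖η x‖ ≤ |η x 0| + |η x 1| + |η x 2| := by
      apply le_of_sq_le_sq _ (by positivity)
      rw [norm_sq3, ← sq_abs (η x 0), ← sq_abs (η x 1), ← sq_abs (η x 2)]
      nlinarith [mul_nonneg (abs_nonneg (η x 0)) (abs_nonneg (η x 1)),
        mul_nonneg (abs_nonneg (η x 0)) (abs_nonneg (η x 2)),
        mul_nonneg (abs_nonneg (η x 1)) (abs_nonneg (η x 2))]
    have hi0 : 0 ≤ (Set.Icc (-(1 / √(1 - γ ^ 2))) (1 / √(1 - γ ^ 2))).indicator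
        (fun _ => (1 : ℝ)) x := Set.indicator_nonneg (fun _ _ => zero_le_one) x
    linarith [abs_nonneg (η x 1), abs_nonneg (η x 2)]

/-- pointwise relations between the coordinates and their derivatives -/
lemma pw_upper {γ : ℝ} (hγ : -1 < γ ∧ γ < 1) {s : ℝ} (hs : s ^ 2 = 1) {η : ℝ → E3}
    (hη : ContDiff ℝ 1 η) (x : ℝ) :
    |muE γ s η x| ≤ ‖η x‖ ∧ |nuE γ s η x| ≤ ‖η x‖ ∧ |rhoE γ s η x| ≤ ‖η x‖ ∧
    |deriv (muE γ s η) x| ≤ 2 * ‖deriv η x‖ + 2 * ‖η x‖ ∧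
    |deriv (nuE γ s η) x| ≤ 2 * ‖deriv η x‖ + 2 * ‖η x‖ ∧
    |deriv (rhoE γ s η) x| ≤ 2 * ‖deriv η x‖ + 2 * ‖η x‖ := by
  have h1 := norm_eta γ s η x hs
  have h2 := norm_eta' γ s η x hs
  have h3 := norm_deta γ s η x hs
  have n0 := norm_nonneg (η x)
  have n1 := norm_nonneg (deriv η x)
  have aux : ∀ {a b : ℝ}, 0 ≤ b → a ^ 2 ≤ b ^ 2 → |a| ≤ b := fun hb h =>
    abs_le_of_sq_le_sq h hb
  have bm : |muE γ s η x| ≤ ‖η x‖ := aux n0 (by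
    rw [h2]; nlinarith [sq_nonneg (nuE γ s η x), sq_nonneg (rhoE γ s η x)])
  have bn : |nuE γ s η x| ≤ ‖η x‖ := aux n0 (by
    rw [h2]; nlinarith [sq_nonneg (muE γ s η x), sq_nonneg (rhoE γ s η x)])
  have br : |rhoE γ s η x| ≤ ‖η x‖ := aux n0 (by
    rw [h2]; nlinarith [sq_nonneg (muE γ s η x), sq_nonneg (nuE γ s η x)])
  have bb : |bE γ s η x| ≤ ‖η x‖ := aux n0 (by
    rw [h1]; nlinarith [sq_nonneg (η x 0), sq_nonneg (rhoE γ s η x)])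
  have ba : |deriv η x 0| ≤ ‖deriv η x‖ := comp_le _ _
  have bp : |pE γ s η x| ≤ ‖deriv η x‖ := aux n1 (by
    rw [h3]; nlinarith [sq_nonneg (deriv η x 0), sq_nonneg (qE γ s η x)])
  have bq : |qE γ s η x| ≤ ‖deriv η x‖ := aux n1 (by
    rw [h3]; nlinarith [sq_nonneg (deriv η x 0), sq_nonneg (pE γ s η x)])
  have hc := Real.abs_cos_le_one (thetaStar γ x)
  have hsn := Real.abs_sin_le_one (thetaStar γ x)
  have hg : |γ| ≤ 1 := (abs_lt.2 hγ).le
  have hk : |√(1 - γ ^ 2)| ≤ 1 := by rw [abs_of_nonneg (Real.sqrt_nonneg _)]; exact kap_le γ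
  have ml : ∀ {a b c : ℝ}, |a| ≤ 1 → |b| ≤ c → |a * b| ≤ c := fun {a b c} ha hb => by
    rw [abs_mul]
    nlinarith [abs_nonneg a, abs_nonneg b]
  have hks : |√(1 - γ ^ 2) * Real.sin (thetaStar γ x)| ≤ 1 := ml hk hsn
  have hpr : |pE γ s η x - γ * rhoE γ s η x| ≤ ‖deriv η x‖ + ‖η x‖ :=
    (abs_sub _ _).trans (add_le_add bp (ml hg br))
  have hsn' : |-Real.sin (thetaStar γ x)| ≤ 1 := by rwa [abs_neg]
  refine ⟨bm, bn, br, ?_, ?_, ?_⟩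
  · rw [(muE_deriv γ s x hs hη).deriv]
    refine (abs_sub _ _).trans ?_
    have := abs_add_le (Real.cos (thetaStar γ x) * deriv η x 0)
      (Real.sin (thetaStar γ x) * (pE γ s η x - γ * rhoE γ s η x))
    linarith [ml hc ba, ml hsn hpr, ml hks bn]
  · rw [(nuE_deriv γ s x hs hη).deriv]
    refine (abs_add_le _ _).trans ?_
    have := abs_add_le (-Real.sin (thetaStar γ x) * deriv η x 0)
      (Real.cos (thetaStar γ x) * (pE γ s η x - γ * rhoE γ s η x))
    linarith [ml hsn' ba, ml hc hpr, ml hks bm]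
  · rw [(rhoE_deriv γ s x hη).deriv]
    refine (abs_add_le _ _).trans ?_
    linarith [ml hg bb]

set_option maxHeartbeats 2000000 in
/-- converse pointwise bounds -/
lemma pw_lower {γ : ℝ} (hγ : -1 < γ ∧ γ < 1) {s : ℝ} (hs : s ^ 2 = 1) {η : ℝ → E3}
    (hη : ContDiff ℝ 1 η) (hn : ∀ x, ‖wStar γ s x + η x‖ = 1) (hsm : ∀ x, ‖η x‖ ≤ 1) (x : ℝ) :
    |muE γ s η x| ≤ |nuE γ s η x| * |nuE γ s η x| + |rhoE γ s η x| * |rhoE γ s η x| ∧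
    |deriv (muE γ s η) x| ≤ 2 * (|nuE γ s η x| * |deriv (nuE γ s η) x|
      + |rhoE γ s η x| * |deriv (rhoE γ s η) x|) ∧
    ‖η x‖ ≤ 2 * (|nuE γ s η x| + |rhoE γ s η x|) ∧
    ‖deriv η x‖ ≤ 20 * (|nuE γ s η x| + |rhoE γ s η x| + |deriv (nuE γ s η) x|
      + |deriv (rhoE γ s η) x|) := by
  obtain ⟨_, bn, br, _, _, _⟩ := pw_upper hγ hs hη x
  have hc := constraint γ s η x hs (hn x)
  have h2 := norm_eta' γ s η x hs
  have h3 := norm_deta γ s η x hs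
  have n0 := norm_nonneg (η x)
  have n1 := norm_nonneg (deriv η x)
  have hx := hsm x
  have cm := ((muE_cd γ s hη).differentiable (by norm_num) x).hasDerivAt
  have cn := ((nuE_cd γ s hs hη).differentiable (by norm_num) x).hasDerivAt
  have cr := ((rhoE_cd γ s hη).differentiable (by norm_num) x).hasDerivAt
  have hdc : (1 + muE γ s η x) * deriv (muE γ s η) x =
      -(nuE γ s η x * deriv (nuE γ s η) x + rhoE γ s η x * deriv (rhoE γ s η) x) := by
    have t := (cm.const_mul 2).add (((cm.pow 2).add (cn.pow 2)).add (cr.pow 2))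
    have z : HasDerivAt (fun _ : ℝ => (0 : ℝ)) 0 x := hasDerivAt_const _ _
    have e : ((fun y => 2 * muE γ s η y) + (muE γ s η ^ 2 + nuE γ s η ^ 2 + rhoE γ s η ^ 2))
        = fun _ : ℝ => (0 : ℝ) := by
      funext y
      have := constraint γ s η y hs (hn y)
      simpa using this
    rw [e] at t
    have u := t.unique z
    norm_num at u
    linear_combination u / 2
  have dm := (muE_deriv γ s x hs hη).deriv
  have dn := (nuE_deriv γ s x hs hη).deriv
  have dr := (rhoE_deriv γ s x hη).deriv
  have em := muE_eq γ s η x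
  have en := nuE_eq γ s η x hs
  have hcc := Real.abs_cos_le_one (thetaStar γ x)
  have hsn := Real.abs_sin_le_one (thetaStar γ x)
  have hθ := Real.sin_sq_add_cos_sq (thetaStar γ x)
  have hg : |γ| ≤ 1 := (abs_lt.2 hγ).le
  have hk : |√(1 - γ ^ 2)| ≤ 1 := by rw [abs_of_nonneg (Real.sqrt_nonneg _)]; exact kap_le γ
  have ml : ∀ {a b c : ℝ}, |a| ≤ 1 → |b| ≤ c → |a * b| ≤ c := fun {a b c} ha hb => by
    rw [abs_mul]
    nlinarith [abs_nonneg a, abs_nonneg b]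
  have hks : |√(1 - γ ^ 2) * Real.sin (thetaStar γ x)| ≤ 1 := ml hk hsn
  generalize deriv (muE γ s η) x = m' at *
  generalize deriv (nuE γ s η) x = n' at *
  generalize deriv (rhoE γ s η) x = r' at *
  generalize muE γ s η x = m at *
  generalize nuE γ s η x = n at *
  generalize rhoE γ s η x = r at *
  generalize pE γ s η x = P at *
  generalize qE γ s η x = Q at *
  generalize bE γ s η x = B at *
  generalize deriv η x 0 = a' at *
  generalize η x 0 = a at *
  generalize Real.cos (thetaStar γ x) = c at *
  generalize Real.sin (thetaStar γ x) = σ at *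
  generalize √(1 - γ ^ 2) = k at *
  generalize ‖η x‖ = N at *
  generalize ‖deriv η x‖ = N' at *
  clear cm cn cr hn hsm hη hs
  have hm0 : m = -(N ^ 2) / 2 := by linarith
  have hm1 : |m| ≤ 1 / 2 := by
    have h1 : N ^ 2 ≤ 1 := pow_le_one₀ n0 hx
    have h0 := sq_nonneg N
    rw [hm0]; apply abs_le.2; constructor <;> linarith
  have hm1' := abs_le.1 hm1
  have hm2 : m ^ 2 ≤ 1 / 2 * |m| := by
    rw [← sq_abs, sq]
    exact mul_le_mul_of_nonneg_right hm1 (abs_nonneg m)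
  have am : |m| = -m := abs_of_nonpos (by rw [hm0]; linarith [sq_nonneg N])
  have hA : |m| ≤ |n| * |n| + |r| * |r| := by
    rw [abs_mul_abs_self, abs_mul_abs_self]
    linarith [abs_nonneg m, sq n, sq r]
  have hB : |m'| ≤ 2 * (|n| * |n'| + |r| * |r'|) := by
    have e : |(1 + m)| * |m'| ≤ |n| * |n'| + |r| * |r'| := by
      rw [← abs_mul, hdc, abs_neg]
      refine (abs_add_le _ _).trans ?_
      rw [abs_mul, abs_mul]
    rw [abs_of_nonneg (by linarith)] at e
    have e2 := mul_le_mul_of_nonneg_right (show 1 / 2 ≤ 1 + m by linarith) (abs_nonneg m')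
    linarith
  have hn1 : |n| ≤ 1 := bn.trans hx
  have hr1 : |r| ≤ 1 := br.trans hx
  have hAB : |m| ≤ |n| + |r| := by
    linarith [mul_le_of_le_one_left (abs_nonneg n) hn1, mul_le_of_le_one_left (abs_nonneg r) hr1]
  have hB' : |m'| ≤ 2 * (|n'| + |r'|) := by
    linarith [mul_le_of_le_one_left (abs_nonneg n') hn1,
      mul_le_of_le_one_left (abs_nonneg r') hr1]
  refine ⟨hA, hB, ?_, ?_⟩
  · apply le_of_sq_le_sq _ (by positivity)
    have : m ^ 2 ≤ 1 / 4 * N ^ 2 := by rw [hm0]; nlinarith [sq_nonneg N]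
    have e1 := sq_abs n
    have e2 := sq_abs r
    nlinarith [mul_nonneg (abs_nonneg n) (abs_nonneg r), sq_nonneg n, sq_nonneg r]
  · have ea' : a' = c * (m' + k * σ * n) - σ * (n' - k * σ * m) := by
      rw [dm, dn]; linear_combination -a' * hθ
    have eP : P = σ * (m' + k * σ * n) + c * (n' - k * σ * m) + γ * r := by
      rw [dm, dn]; linear_combination (-P + γ * r) * hθ
    have eB : B = σ * m + c * n := by
      rw [em, en]; linear_combination -B * hθ
    have eQ : Q = r' - γ * B := by rw [dr]; ring
    have u1 : |m' + k * σ * n| ≤ |m'| + |n| :=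
      (abs_add_le _ _).trans (by linarith [ml hks le_rfl (b := n)])
    have u2 : |n' - k * σ * m| ≤ |n'| + |m| :=
      (abs_sub _ _).trans (by linarith [ml hks le_rfl (b := m)])
    have v1 : |a'| ≤ |m'| + |n| + |n'| + |m| := by
      rw [ea']
      exact (abs_sub _ _).trans (by linarith [ml hcc u1, ml hsn u2])
    have v2 : |P| ≤ |m'| + |n| + |n'| + |m| + |r| := by
      rw [eP]
      have := abs_add_le (σ * (m' + k * σ * n)) (c * (n' - k * σ * m))
      exact (abs_add_le _ _).trans
        (by linarith [ml hsn u1, ml hcc u2, ml hg le_rfl (b := r)])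
    have v3 : |Q| ≤ |r'| + |m| + |n| := by
      rw [eQ]
      have : |B| ≤ |m| + |n| := by
        rw [eB]
        exact (abs_add_le _ _).trans
          (by linarith [ml hsn le_rfl (b := m), ml hcc le_rfl (b := n)])
      exact (abs_sub _ _).trans (by linarith [ml hg this])
    have hN : N' ≤ |a'| + |P| + |Q| := by
      apply le_of_sq_le_sq _ (by positivity)
      rw [h3, ← sq_abs a', ← sq_abs P, ← sq_abs Q]
      nlinarith [mul_nonneg (abs_nonneg a') (abs_nonneg P),
        mul_nonneg (abs_nonneg a') (abs_nonneg Q),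
        mul_nonneg (abs_nonneg P) (abs_nonneg Q)]
    linarith [abs_nonneg n, abs_nonneg r, abs_nonneg n', abs_nonneg r']

lemma integral_five {A B C D R : ℝ → ℝ} (hA : Integrable A) (hB : Integrable B)
    (hC : Integrable C) (hD : Integrable D) (hR : Integrable R) :
    ∫ x, (A x + B x + C x - D x + R x) =
      (∫ x, A x) + (∫ x, B x) + (∫ x, C x) - (∫ x, D x) + ∫ x, R x := by
  have hAB : Integrable (fun x => A x + B x) := hA.add hB
  have hABC : Integrable (fun x => A x + B x + C x) := hAB.add hC
  have hABCD : Integrable (fun x => A x + B x + C x - D x) := hABC.sub hD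
  rw [integral_add hABCD hR, integral_sub hABC hD, integral_add hAB hC, integral_add hA hB]

/-- expansion of the energy around the domain wall w_*. -/
theorem energy_expansion (γ : ℝ) (hγ : -1 < γ ∧ γ < 1) (s : ℝ) (hs : s = 1 ∨ s = -1) :
    ∃ δ₃ C₃ : ℝ, 0 < δ₃ ∧ 0 < C₃ ∧
      ∀ η : ℝ → E3, ContDiff ℝ 1 η → (∀ x, ‖wStar γ s x + η x‖ = 1) →
      MemLp (fun x => η x 1) 2 volume → MemLp (fun x => η x 2) 2 volume →
      MemLp (deriv η) 2 volume → HH1 η ≤ δ₃ →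
      -- μ, ν, ρ belong to H¹ (and η itself belongs to L²)
      (MemLp (muE γ s η) 2 volume ∧ MemLp (deriv (muE γ s η)) 2 volume) ∧
      (MemLp (nuE γ s η) 2 volume ∧ MemLp (deriv (nuE γ s η)) 2 volume) ∧
      (MemLp (rhoE γ s η) 2 volume ∧ MemLp (deriv (rhoE γ s η)) 2 volume) ∧
      MemLp η 2 volume ∧
      -- μ is quadratic in (ν,ρ)
      H1norm (muE γ s η) ≤ C₃ * (H1norm (nuE γ s η) + H1norm (rhoE γ s η)) ^ 2 ∧
      -- equivalence of norms
      (1 / C₃) * H1norm η ≤ H1norm (nuE γ s η) + H1norm (rhoE γ s η) ∧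
      H1norm (nuE γ s η) + H1norm (rhoE γ s η) ≤ C₃ * H1norm η ∧
      -- energy expansion at second order
      |energy γ (fun x => wStar γ s x + η x) - energy γ (wStar γ s)
          - (1 / 2) * (Qform γ (nuE γ s η) + Qform γ (rhoE γ s η))|
        ≤ C₃ * (H1norm (nuE γ s η) + H1norm (rhoE γ s η)) ^ 3 := by
  have hs2 : s ^ 2 = 1 := by rcases hs with h | h <;> rw [h] <;> norm_num
  have hk := kap_pos hγ
  have hk1 := kap_le γ
  refine ⟨√(1 - γ ^ 2) / 1000, 100, by positivity, by norm_num, ?_⟩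
  intro η hη hn h1 h2 hd hδ
  obtain ⟨hsm, hL⟩ := small hγ hs2 hη hn h1 h2 hd hδ
  have up := pw_upper hγ hs2 hη
  have lo := pw_lower hγ hs2 hη hn hsm
  have hh : MemLp (fun x => ‖η x‖ + ‖deriv η x‖) 2 volume := hL.norm.add hd.norm
  have cm := muE_cd γ s hη
  have cn := nuE_cd γ s hs2 hη
  have cr := rhoE_cd γ s hη
  have cm' := cm.continuous_deriv_one
  have cn' := cn.continuous_deriv_one
  have cr' := cr.continuous_deriv_one
  have nn0 := fun x => norm_nonneg (η x)
  have nn1 := fun x => norm_nonneg (deriv η x)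
  have Bn : ∀ x, ‖nuE γ s η x‖ ≤ 2 * (‖η x‖ + ‖deriv η x‖) := fun x => by
    rw [Real.norm_eq_abs]; linarith [up x, nn0 x, nn1 x]
  have Br : ∀ x, ‖rhoE γ s η x‖ ≤ 2 * (‖η x‖ + ‖deriv η x‖) := fun x => by
    rw [Real.norm_eq_abs]; linarith [up x, nn0 x, nn1 x]
  have Bn' : ∀ x, ‖deriv (nuE γ s η) x‖ ≤ 2 * (‖η x‖ + ‖deriv η x‖) := fun x => by
    rw [Real.norm_eq_abs]; linarith [up x, nn0 x, nn1 x]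
  have Br' : ∀ x, ‖deriv (rhoE γ s η) x‖ ≤ 2 * (‖η x‖ + ‖deriv η x‖) := fun x => by
    rw [Real.norm_eq_abs]; linarith [up x, nn0 x, nn1 x]
  have Mm : MemLp (muE γ s η) 2 volume := memLp_le (c := 2) hh cm.continuous fun x => by
    rw [Real.norm_eq_abs]; linarith [up x, nn0 x, nn1 x]
  have Mm' : MemLp (deriv (muE γ s η)) 2 volume := memLp_le (c := 2) hh cm' fun x => by
    rw [Real.norm_eq_abs]; linarith [up x, nn0 x, nn1 x]
  have Mn : MemLp (nuE γ s η) 2 volume := memLp_le hh cn.continuous Bn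
  have Mr : MemLp (rhoE γ s η) 2 volume := memLp_le hh cr.continuous Br
  have Mn' : MemLp (deriv (nuE γ s η)) 2 volume := memLp_le hh cn' Bn'
  have Mr' : MemLp (deriv (rhoE γ s η)) 2 volume := memLp_le hh cr' Br'
  have hLh : L2norm (fun x => ‖η x‖ + ‖deriv η x‖) ≤ H1norm η := by
    refine (l2_add hL.norm hd.norm).trans ?_
    rw [l2_norm, l2_norm, H1norm]
  -- the comparison function
  have Mf1 : MemLp (fun x => |nuE γ s η x| + |rhoE γ s η x|) 2 volume := Mn.norm.add Mr.norm
  have Mf2 : MemLp (fun x => |nuE γ s η x| + |rhoE γ s η x| + |deriv (nuE γ s η) x|) 2 volume :=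
    Mf1.add Mn'.norm
  have Mf : MemLp (fun x => |nuE γ s η x| + |rhoE γ s η x| + |deriv (nuE γ s η) x|
      + |deriv (rhoE γ s η) x|) 2 volume := Mf2.add Mr'.norm
  have Lf : L2norm (fun x => |nuE γ s η x| + |rhoE γ s η x| + |deriv (nuE γ s η) x|
      + |deriv (rhoE γ s η) x|) ≤ H1norm (nuE γ s η) + H1norm (rhoE γ s η) := by
    have a1 := l2_add Mn.norm Mr.norm
    have a2 := l2_add Mf1 Mn'.norm
    have a3 := l2_add Mf2 Mr'.norm
    rw [l2_norm] at a1 a2 a3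
    rw [l2_norm] at a1
    simp only [Real.norm_eq_abs] at a1 a2 a3
    unfold H1norm
    linarith
  have sn := sobolev cn Mn Mn'
  have sr := sobolev cr Mr Mr'
  have pn : 0 ≤ H1norm (nuE γ s η) := add_nonneg (l2_nonneg _) (l2_nonneg _)
  have pr : 0 ≤ H1norm (rhoE γ s η) := add_nonneg (l2_nonneg _) (l2_nonneg _)
  have HN : H1norm (nuE γ s η) + H1norm (rhoE γ s η) ≤ 100 * H1norm η := by
    have a1 := l2_le_mul (by norm_num) hh Bn
    have a2 := l2_le_mul (by norm_num) hh Br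
    have a3 := l2_le_mul (by norm_num) hh Bn'
    have a4 := l2_le_mul (by norm_num) hh Br'
    have a5 : 0 ≤ H1norm η := add_nonneg (l2_nonneg _) (l2_nonneg _)
    have e : H1norm (nuE γ s η) + H1norm (rhoE γ s η) = L2norm (nuE γ s η)
      + L2norm (deriv (nuE γ s η)) + (L2norm (rhoE γ s η) + L2norm (deriv (rhoE γ s η))) := rfl
    linarith
  generalize hNdef : H1norm (nuE γ s η) + H1norm (rhoE γ s η) = N at *
  have N0 : 0 ≤ N := by linarith
  generalize hfdef : (fun x => |nuE γ s η x| + |rhoE γ s η x| + |deriv (nuE γ s η) x|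
      + |deriv (rhoE γ s η) x|) = f at *
  have hf : ∀ x, f x = |nuE γ s η x| + |rhoE γ s η x| + |deriv (nuE γ s η) x|
      + |deriv (rhoE γ s η) x| := fun x => by rw [← hfdef]
  have f0 : ∀ x, 0 ≤ f x := fun x => by rw [hf]; positivity
  have nN : ∀ x, |nuE γ s η x| ≤ N := fun x => by linarith [sn x]
  have rN : ∀ x, |rhoE γ s η x| ≤ N := fun x => by linarith [sr x]
  have mN : ∀ x, |muE γ s η x| ≤ N * f x := fun x => by
    rw [hf]
    nlinarith [(lo x).1, mul_le_mul_of_nonneg_right (nN x) (abs_nonneg (nuE γ s η x)),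
      mul_le_mul_of_nonneg_right (rN x) (abs_nonneg (rhoE γ s η x)),
      mul_nonneg N0 (abs_nonneg (deriv (nuE γ s η) x)),
      mul_nonneg N0 (abs_nonneg (deriv (rhoE γ s η) x))]
  have mN' : ∀ x, |deriv (muE γ s η) x| ≤ (2 * N) * f x := fun x => by
    rw [hf]
    nlinarith [(lo x).2.1, mul_le_mul_of_nonneg_right (nN x) (abs_nonneg (deriv (nuE γ s η) x)),
      mul_le_mul_of_nonneg_right (rN x) (abs_nonneg (deriv (rhoE γ s η) x)),
      mul_nonneg N0 (abs_nonneg (nuE γ s η x)),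
      mul_nonneg N0 (abs_nonneg (rhoE γ s η x))]
  have Lf0 := l2_nonneg f
  refine ⟨⟨Mm, Mm'⟩, ⟨Mn, Mn'⟩, ⟨Mr, Mr'⟩, hL, ?_, ?_, HN, ?_⟩
  · have a1 := l2_le_mul (u := muE γ s η) N0 Mf mN
    have a2 := l2_le_mul (u := deriv (muE γ s η)) (by positivity) Mf mN'
    unfold H1norm
    nlinarith [mul_le_mul_of_nonneg_left Lf N0]
  · have a1 : L2norm η ≤ 2 * L2norm f := l2_le_mul (by norm_num) Mf fun x => by
      rw [hf]; linarith [(lo x).2.2.1, abs_nonneg (deriv (nuE γ s η) x),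
        abs_nonneg (deriv (rhoE γ s η) x)]
    have a2 : L2norm (deriv η) ≤ 20 * L2norm f := l2_le_mul (by norm_num) Mf fun x => by
      rw [hf]; exact (lo x).2.2.2
    unfold H1norm
    linarith
  · have Ms := sin_memLp hγ
    have is2 : Integrable (fun x => 2 * (1 - γ ^ 2) * Real.sin (thetaStar γ x) ^ 2) :=
      Ms.integrable_sq.const_mul _
    have iQ : ∀ v : ℝ → ℝ, Continuous v → MemLp v 2 volume → MemLp (deriv v) 2 volume →
        Integrable (fun x => (deriv v x) ^ 2
          + (1 - γ ^ 2) * (Real.cos (thetaStar γ x) ^ 2 - Real.sin (thetaStar γ x) ^ 2)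
            * (v x) ^ 2) := fun v hvc hv hv' => by
      refine hv'.integrable_sq.add (Integrable.mono' hv.integrable_sq ?_ ?_)
      · exact ((continuous_const.mul (((cosθ_cd γ).continuous.pow 2).sub
          ((sinθ_cd γ).continuous.pow 2))).mul (hvc.pow 2)).aestronglyMeasurable
      · refine Eventually.of_forall fun x => ?_
        have hθ := Real.sin_sq_add_cos_sq (thetaStar γ x)
        rw [norm_mul, Real.norm_of_nonneg (sq_nonneg (v x)), Real.norm_eq_abs]
        refine mul_le_of_le_one_left (sq_nonneg _) ?_
        rw [abs_mul]
        refine mul_le_one₀ ?_ (abs_nonneg _) ?_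
        · rw [abs_le]; constructor <;> nlinarith [sq_nonneg γ, hγ.1, hγ.2]
        · rw [abs_le]; constructor <;> nlinarith [sq_nonneg (Real.cos (thetaStar γ x)),
            sq_nonneg (Real.sin (thetaStar γ x))]
    have iQn := iQ _ cn.continuous Mn Mn'
    have iQr := iQ _ cr.continuous Mr Mr'
    have dT : ∀ x, HasDerivAt (fun x => Real.sin (thetaStar γ x) * nuE γ s η x)
        (-√(1 - γ ^ 2) * Real.sin (thetaStar γ x) * Real.cos (thetaStar γ x)
          * nuE γ s η x + Real.sin (thetaStar γ x) * deriv (nuE γ s η) x) x := fun x =>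
      (sin_deriv γ x).mul (cn.differentiable (by norm_num) x).hasDerivAt
    have iT0 : Integrable (fun x => Real.sin (thetaStar γ x) * nuE γ s η x) :=
      Ms.integrable_mul Mn
    have iT1 : Integrable (fun x => Real.sin (thetaStar γ x) * deriv (nuE γ s η) x) :=
      Ms.integrable_mul Mn'
    have iT : Integrable (fun x => -√(1 - γ ^ 2) * Real.sin (thetaStar γ x)
          * Real.cos (thetaStar γ x)
          * nuE γ s η x + Real.sin (thetaStar γ x) * deriv (nuE γ s η) x) := by
      refine Integrable.add (Integrable.mono' iT0.norm ?_ ?_) iT1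
      · exact (((continuous_const.mul (sinθ_cd γ).continuous).mul
          (cosθ_cd γ).continuous).mul cn.continuous).aestronglyMeasurable
      · refine Eventually.of_forall fun x => ?_
        have e : -√(1 - γ ^ 2) * Real.sin (thetaStar γ x) * Real.cos (thetaStar γ x)
          * nuE γ s η x = (-√(1 - γ ^ 2) * Real.cos (thetaStar γ x)) *
            (Real.sin (thetaStar γ x) * nuE γ s η x) := by ring
        rw [e, norm_mul]
        refine mul_le_of_le_one_left (norm_nonneg _) ?_
        rw [Real.norm_eq_abs, abs_mul, abs_neg, abs_of_pos hk]
        exact mul_le_one₀ hk1 (abs_nonneg _) (Real.abs_cos_le_one _)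
    have zT := integral_eq_zero_of_hasDerivAt_of_integrable dT iT iT0
    have iT' := iT.const_mul (2 * √(1 - γ ^ 2))
    have bR : ∀ x, |remE γ s η x| ≤ (16 * N) * f x ^ 2 := fun x => by
      have hsn := Real.abs_sin_le_one (thetaStar γ x)
      have hcs := Real.abs_cos_le_one (thetaStar γ x)
      have g1 := mN x
      have g2 := mN' x
      have hx1 := hsm x
      have g3 : |deriv (muE γ s η) x| ≤ 2 * f x := by
        have q1 := ((up x).2.1).trans hx1
        have q2 := ((up x).2.2.1).trans hx1
        rw [hf]
        linarith [(lo x).2.1, mul_le_of_le_one_left (abs_nonneg (deriv (nuE γ s η) x)) q1,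
          mul_le_of_le_one_left (abs_nonneg (deriv (rhoE γ s η) x)) q2,
          abs_nonneg (nuE γ s η x), abs_nonneg (rhoE γ s η x)]
      have g4 : |nuE γ s η x| ≤ f x := by
        rw [hf]
        linarith [abs_nonneg (rhoE γ s η x),
          abs_nonneg (deriv (nuE γ s η) x), abs_nonneg (deriv (rhoE γ s η) x)]
      have g5 : |deriv (nuE γ s η) x| ≤ f x := by
        rw [hf]
        linarith [abs_nonneg (rhoE γ s η x),
          abs_nonneg (nuE γ s η x), abs_nonneg (deriv (rhoE γ s η) x)]
      have ff := f0 x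
      unfold remE
      generalize deriv (muE γ s η) x = m' at *
      generalize deriv (nuE γ s η) x = n' at *
      generalize muE γ s η x = m at *
      generalize nuE γ s η x = n at *
      generalize Real.cos (thetaStar γ x) = c at *
      generalize Real.sin (thetaStar γ x) = σ at *
      generalize √(1 - γ ^ 2) = k at *
      generalize f x = F at *
      have NF : 0 ≤ N * F := by positivity
      have ml : ∀ {a b c : ℝ}, |a| ≤ 1 → |b| ≤ c → |a * b| ≤ c := fun {a b c} ha hb => by
        rw [abs_mul]
        nlinarith [abs_nonneg a, abs_nonneg b]
      have hk' : |k| ≤ 1 := by rwa [abs_of_pos hk]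
      have k1 : |m' ^ 2| ≤ (2 * N * F) * (2 * F) := by
        rw [sq, abs_mul]; exact mul_le_mul g2 g3 (abs_nonneg _) (by positivity)
      have k2 : |n * m'| ≤ F * (2 * N * F) := by
        rw [abs_mul]; exact mul_le_mul g4 g2 (abs_nonneg _) ff
      have k3 : |m * n'| ≤ (N * F) * F := by
        rw [abs_mul]; exact mul_le_mul g1 g5 (abs_nonneg _) NF
      have k4 : |m * n| ≤ (N * F) * F := by
        rw [abs_mul]; exact mul_le_mul g1 g4 (abs_nonneg _) NF
      have k5 : |n * m' - m * n'| ≤ F * (2 * N * F) + (N * F) * F :=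
        (abs_sub _ _).trans (add_le_add k2 k3)
      have k6 := ml (ml hk' hsn) k5
      have k7 := ml (ml (ml (ml hk' hk') hcs) hsn) k4
      have e : m' ^ 2 + 2 * k * σ * (n * m' - m * n') + 2 * k ^ 2 * c * σ * m * n
        = m' ^ 2 + 2 * ((k * σ) * (n * m' - m * n')) + 2 * (k * k * c * σ * (m * n)) := by ring
      rw [e]
      refine (abs_add_le _ _).trans ?_
      have := abs_add_le (m' ^ 2) (2 * ((k * σ) * (n * m' - m * n')))
      rw [abs_mul 2, abs_two] at this ⊢
      have FF : 0 ≤ N * F * F := by positivity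
      linarith [FF]
    have cR : Continuous (remE γ s η) := by
      have c1 := (sinθ_cd γ).continuous
      have c2 := (cosθ_cd γ).continuous
      have c3 := cm.continuous
      have c4 := cn.continuous
      unfold remE
      fun_prop
    have iF := Mf.integrable_sq.const_mul (16 * N)
    have iR : Integrable (remE γ s η) :=
      Integrable.mono' iF cR.aestronglyMeasurable (Eventually.of_forall bR)
    have RB : |∫ x, remE γ s η x| ≤ 16 * N ^ 3 := by
      have e1 := l2_sq Mf
      simp only [Real.norm_eq_abs, sq_abs] at e1
      have : |∫ x, remE γ s η x| ≤ ∫ x, (16 * N) * f x ^ 2 :=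
        norm_integral_le_of_norm_le (f := remE γ s η) iF (Eventually.of_forall bR)
      rw [integral_const_mul, ← e1] at this
      have l2 : L2norm f ^ 2 ≤ N ^ 2 := pow_le_pow_left₀ Lf0 Lf 2
      have := mul_le_mul_of_nonneg_left l2 (show 0 ≤ 16 * N by positivity)
      nlinarith
    have E1 : energy γ (fun x => wStar γ s x + η x) = 1 / 2 *
        ((∫ x, 2 * (1 - γ ^ 2) * Real.sin (thetaStar γ x) ^ 2)
          + Qform γ (nuE γ s η) + Qform γ (rhoE γ s η) + ∫ x, remE γ s η x) := by
      unfold energy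
      simp only [density γ s _ hγ hs2 hη (hn _)]
      congr 1
      refine (integral_five is2 iQn iQr iT' iR).trans ?_
      rw [integral_const_mul (2 * √(1 - γ ^ 2)), zT]
      unfold Qform
      ring
    have E0 : energy γ (wStar γ s) = 1 / 2 *
        ((∫ x, 2 * (1 - γ ^ 2) * Real.sin (thetaStar γ x) ^ 2)) := by
      have hz : ∀ x, ‖wStar γ s x + (fun _ : ℝ => (0 : E3)) x‖ = 1 := fun x => by
        have := norm_sq3 (wStar γ s x)
        rw [(w_comp γ s x hs2).2.2] at this
        simp only [add_zero]
        exact (pow_eq_one_iff_of_nonneg (norm_nonneg _) two_ne_zero).1 this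
      have z1 : muE γ s (fun _ : ℝ => (0 : E3)) = fun _ => 0 := by
        funext x; simp [muE, dot3]
      have z2 : nuE γ s (fun _ : ℝ => (0 : E3)) = fun _ => 0 := by
        funext x; simp [nuE, dot3]
      have z3 : rhoE γ s (fun _ : ℝ => (0 : E3)) = fun _ => 0 := by
        funext x; simp [rhoE, dot3]
      have hdens := fun x => density γ s x hγ hs2 (η := fun _ : ℝ => (0 : E3)) contDiff_const (hz x)
      simp only [add_zero, remE, z1, z2, z3] at hdens
      unfold energy
      have hw : (fun x => wStar γ s x) = wStar γ s := rfl
      congr 1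
      refine integral_congr_ae (Eventually.of_forall fun x => ?_)
      have := hdens x
      simp only [deriv_const] at this
      simp only
      refine this.trans ?_
      ring
    rw [E1, E0]
    have e : 1 / 2 * ((∫ x, 2 * (1 - γ ^ 2) * Real.sin (thetaStar γ x) ^ 2)
          + Qform γ (nuE γ s η) + Qform γ (rhoE γ s η) + ∫ x, remE γ s η x)
        - 1 / 2 * (∫ x, 2 * (1 - γ ^ 2) * Real.sin (thetaStar γ x) ^ 2)
        - 1 / 2 * (Qform γ (nuE γ s η) + Qform γ (rhoE γ s η)) = 1 / 2 * ∫ x, remE γ s η x := by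
      ring
    rw [e, abs_mul, abs_of_pos (by norm_num : (0 : ℝ) < 1 / 2)]
    have : 0 ≤ N ^ 3 := by positivity
    linarith
end
end

section
/- Let m = (m₁,m₂,m₃) : ℝ → ℝ³ be continuously differentiable with |m(x)| = 1 for all x ∈ ℝ, and suppose m₂, m₃ ∈ L²(ℝ) and m′ ∈ L²(ℝ,ℝ³). Then there exist a⁺, a⁻ ∈ {−1, +1} such that m(x) → (a⁺, 0, 0) as x → +∞ and m(x) → (a⁻, 0, 0) as x → −∞; in other words, every finite-ℋ¹ S²-valued map admits limits in {±e₁} at ±∞. -/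
open MeasureTheory Filter ENNReal

noncomputable section

lemma aux_limit (m : ℝ → E3) (hreg : ContDiff ℝ 1 m) (hsph : ∀ x, ‖m x‖ = 1)
    (l : Filter ℝ) (hl : ∀ s ∈ l, ∃ t ∈ l, t ⊆ s ∧ IsPreconnected t)
    (h1 : Tendsto (fun x => m x 1 ^ 2) l (nhds 0))
    (h2 : Tendsto (fun x => m x 2 ^ 2) l (nhds 0)) :
    ∃ a : ℝ, (a = 1 ∨ a = -1) ∧ Tendsto m l (nhds (!₂[a, 0, 0] : E3)) := by
  have hs : ∀ x, m x 0 ^ 2 = 1 - m x 1 ^ 2 - m x 2 ^ 2 := by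
    intro x
    have h := EuclideanSpace.norm_sq_eq (m x)
    rw [hsph x, Fin.sum_univ_three] at h
    simp only [Real.norm_eq_abs, sq_abs] at h
    linarith
  have hc : Continuous (fun x => m x 0) := by
    have := hreg.continuous
    fun_prop
  have h0 : Tendsto (fun x => m x 0 ^ 2) l (nhds 1) := by
    simp only [hs]
    simpa using (tendsto_const_nhds.sub h1).sub h2
  have hroot : ∀ i : Fin 3, ∀ c : ℝ, Tendsto (fun x => m x i ^ 2) l (nhds c) →
      Tendsto (fun x => |m x i|) l (nhds (Real.sqrt c)) := by
    intro i c h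
    simpa [Real.sqrt_sq_eq_abs] using h.sqrt
  have h1' : Tendsto (fun x => m x 1) l (nhds 0) := by
    have := hroot 1 0 h1
    rw [Real.sqrt_zero] at this
    exact (tendsto_zero_iff_abs_tendsto_zero _).2 this
  have h2' : Tendsto (fun x => m x 2) l (nhds 0) := by
    have := hroot 2 0 h2
    rw [Real.sqrt_zero] at this
    exact (tendsto_zero_iff_abs_tendsto_zero _).2 this
  have h0' : Tendsto (fun x => |m x 0|) l (nhds 1) := by
    simpa using hroot 0 1 h0
  obtain ⟨t, ht, hts, hpc⟩ := hl _ (h0'.eventually (lt_mem_nhds (zero_lt_one)))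
  have key : ∃ a : ℝ, (a = 1 ∨ a = -1) ∧ Tendsto (fun x => m x 0) l (nhds a) := by
    rcases hpc.eq_or_eq_neg_of_sq_eq (f := fun x => m x 0) (g := fun x => |m x 0|)
      hc.continuousOn hc.abs.continuousOn (fun x _ => by simp)
      (fun {x} hx => ne_of_gt (hts hx)) with h | h
    · refine ⟨1, Or.inl rfl, h0'.congr' ?_⟩
      filter_upwards [ht] with x hx using (h hx).symm
    · refine ⟨-1, Or.inr rfl, h0'.neg.congr' ?_⟩
      filter_upwards [ht] with x hx using (h hx).symm
  obtain ⟨a, ha, hta⟩ := key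
  refine ⟨a, ha, ?_⟩
  have hp : Tendsto (fun x => (m x).ofLp) l (nhds ![a, 0, 0]) := by
    rw [tendsto_pi_nhds]
    intro i
    fin_cases i
    · exact hta
    · exact h1'
    · exact h2'
  exact ((PiLp.continuous_toLp 2 (fun _ : Fin 3 => ℝ)).tendsto _).comp hp

lemma aux_sq (m : ℝ → E3) (hreg : ContDiff ℝ 1 m) (i : Fin 3)
    (h : MemLp (fun x => m x i) 2 volume) (hd : MemLp (deriv m) 2 volume) :
    Tendsto (fun x => m x i ^ 2) atTop (nhds 0) ∧
    Tendsto (fun x => m x i ^ 2) atBot (nhds 0) := by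
  have hder : ∀ x, HasDerivAt (fun x => m x i ^ 2) (2 * (m x i * deriv m x i)) x := by
    intro x
    have h1 : HasDerivAt m (deriv m x) x :=
      ((hreg.differentiable (by norm_num)) x).hasDerivAt
    have h2 : HasDerivAt (fun x => m x i) (deriv m x i) x :=
      (EuclideanSpace.proj (𝕜 := ℝ) i).hasFDerivAt.comp_hasDerivAt x h1
    have gen : ∀ (u : ℝ → ℝ) (u' : ℝ), HasDerivAt u u' x →
        HasDerivAt (fun x => u x ^ 2) (2 * (u x * u')) x := by
      intro u u' hu
      have h3 := hu.fun_pow 2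
      have e : ((2 : ℕ) : ℝ) * u x ^ (2 - 1) * u' = 2 * (u x * u') := by
        norm_num [mul_assoc]
      rwa [e] at h3
    exact gen _ _ h2
  have hdi : MemLp (fun x => deriv m x i) 2 volume :=
    (EuclideanSpace.proj (𝕜 := ℝ) i : E3 →L[ℝ] ℝ).comp_memLp' hd
  have i1 : Integrable (fun x => m x i ^ 2) volume := h.integrable_sq
  have i2 : Integrable (fun x => 2 * (m x i * deriv m x i)) volume :=
    (h.integrable_mul hdi).const_mul 2
  exact ⟨tendsto_zero_of_hasDerivAt_of_integrableOn_Ioi (a := 0) (fun x _ => hder x)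
      i2.integrableOn i1.integrableOn,
    tendsto_zero_of_hasDerivAt_of_integrableOn_Iic (a := 0) (fun x _ => hder x)
      i2.integrableOn i1.integrableOn⟩

/-- every finite-ℋ¹ S²-valued map admits limits in {±e₁} at ±∞. -/
theorem limits_at_infinity (m : ℝ → E3) (hreg : ContDiff ℝ 1 m) (hsph : ∀ x, ‖m x‖ = 1)
    (h2 : MemLp (fun x => m x 1) 2 volume) (h3 : MemLp (fun x => m x 2) 2 volume)
    (hd : MemLp (deriv m) 2 volume) :
    ∃ ap am : ℝ, (ap = 1 ∨ ap = -1) ∧ (am = 1 ∨ am = -1) ∧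
      Tendsto m atTop (nhds (!₂[ap, 0, 0] : E3)) ∧
      Tendsto m atBot (nhds (!₂[am, 0, 0] : E3)) := by
  obtain ⟨t1, b1⟩ := aux_sq m hreg 1 h2 hd
  obtain ⟨t2, b2⟩ := aux_sq m hreg 2 h3 hd
  obtain ⟨ap, hap, hp⟩ := aux_limit m hreg hsph atTop (fun s hs => by
    obtain ⟨a, ha⟩ := mem_atTop_sets.1 hs
    exact ⟨Set.Ici a, Ici_mem_atTop a, ha, isPreconnected_Ici⟩) t1 t2
  obtain ⟨am, ham, hm⟩ := aux_limit m hreg hsph atBot (fun s hs => by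
    obtain ⟨a, ha⟩ := mem_atBot_sets.1 hs
    exact ⟨Set.Iic a, Iic_mem_atBot a, ha, isPreconnected_Iic⟩) b1 b2
  exact ⟨ap, am, hap, ham, hp, hm⟩
end
end

section
/- Fix γ ∈ (−1,1). There exists a constant C_γ > 0 such that for every continuously differentiable m = (m₁,m₂,m₃) : ℝ → ℝ³ with |m(x)| = 1 for all x: the integrand satisfies the pointwise bound |m′(x)|² + 2γ m′(x)·(e₁ ∧ m(x)) + (1 − m₁(x)²) ≥ (1 − |γ|)·(|m′(x)|² + m₂(x)² + m₃(x)²) for every x ∈ ℝ, and consequently E(m) ≥ C_γ·‖m‖²_{ℋ¹} (with both sides possibly infinite). -/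
open MeasureTheory Filter ENNReal

noncomputable section

theorem pw_bound (γ : ℝ) (hγ : -1 < γ ∧ γ < 1) (d v : E3) (hv : ‖v‖ = 1) :
    (1 - |γ|) * (‖d‖ ^ 2 + (v 1) ^ 2 + (v 2) ^ 2)
      ≤ ‖d‖ ^ 2 + 2 * γ * dot3 d (cross3 e1 v) + (1 - (v 0) ^ 2) := by
  have h1 : (v 0) ^ 2 + (v 1) ^ 2 + (v 2) ^ 2 = 1 := by
    have := EuclideanSpace.real_norm_sq_eq v
    rw [hv, Fin.sum_univ_three] at this
    linarith
  have h2 : ‖d‖ ^ 2 = (d 0) ^ 2 + (d 1) ^ 2 + (d 2) ^ 2 := by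
    rw [EuclideanSpace.real_norm_sq_eq d, Fin.sum_univ_three]
  have h3 : dot3 d (cross3 e1 v) = - d 1 * v 2 + d 2 * v 1 := by
    simp [dot3, cross3, e1]
  rw [h2, h3]
  rcases abs_cases γ with ⟨h, h'⟩ | ⟨h, h'⟩ <;> rw [h]
  · nlinarith [mul_nonneg h' (sq_nonneg (d 1 - v 2)), mul_nonneg h' (sq_nonneg (d 2 + v 1)),
      mul_nonneg h' (sq_nonneg (d 0))]
  · have h'' : 0 ≤ -γ := by linarith
    nlinarith [mul_nonneg h'' (sq_nonneg (d 1 + v 2)), mul_nonneg h'' (sq_nonneg (d 2 - v 1)),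
      mul_nonneg h'' (sq_nonneg (d 0))]

theorem sq_sum_le (a b c : ℝ≥0∞) : (a + b + c) ^ 2 ≤ 3 * (c ^ 2 + a ^ 2 + b ^ 2) := by
  induction a using ENNReal.recTopCoe with
  | top => simp
  | coe a =>
  induction b using ENNReal.recTopCoe with
  | top => simp
  | coe b =>
  induction c using ENNReal.recTopCoe with
  | top => simp
  | coe c =>
  have : (a + b + c) ^ 2 ≤ 3 * (c ^ 2 + a ^ 2 + b ^ 2) := by
    rw [← NNReal.coe_le_coe]
    push_cast
    nlinarith [sq_nonneg ((a : ℝ) - b), sq_nonneg ((a : ℝ) - c), sq_nonneg ((b : ℝ) - c)]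
  exact_mod_cast this

theorem eLpNorm_sq {E : Type*} [NormedAddCommGroup E] (u : ℝ → E) :
    eLpNorm u 2 volume ^ 2 = ∫⁻ x, ENNReal.ofReal (‖u x‖ ^ 2) := by
  have := eLpNorm_nnreal_pow_eq_lintegral (f := u) (μ := volume) (p := 2) (by norm_num)
  simp only [NNReal.coe_ofNat, ENNReal.coe_ofNat, ENNReal.rpow_ofNat] at this
  rw [this]
  refine lintegral_congr fun x => ?_
  rw [ENNReal.ofReal_pow (norm_nonneg _), ofReal_norm]

/-- coercivity of the energy, pointwise and globally (in ℝ≥0∞ so that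
    both sides may be infinite). -/
theorem energy_coercive (γ : ℝ) (hγ : -1 < γ ∧ γ < 1) :
    ∃ C : ℝ, 0 < C ∧
      ∀ m : ℝ → E3, ContDiff ℝ 1 m → (∀ x, ‖m x‖ = 1) →
        (∀ x : ℝ,
          (1 - |γ|) * (‖deriv m x‖ ^ 2 + (m x 1) ^ 2 + (m x 2) ^ 2)
            ≤ ‖deriv m x‖ ^ 2 + 2 * γ * dot3 (deriv m x) (cross3 e1 (m x))
                + (1 - (m x 0) ^ 2)) ∧
        ENNReal.ofReal C *
            (eLpNorm (fun x => m x 1) 2 volume + eLpNorm (fun x => m x 2) 2 volume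
              + eLpNorm (deriv m) 2 volume) ^ 2
          ≤ (1 / 2) * ∫⁻ x : ℝ, ENNReal.ofReal
              (‖deriv m x‖ ^ 2 + 2 * γ * dot3 (deriv m x) (cross3 e1 (m x))
                + (1 - (m x 0) ^ 2)) := by
  have hg : 0 < 1 - |γ| := by
    have := abs_lt.mpr hγ
    linarith
  refine ⟨(1 - |γ|) / 6, by positivity, fun m hm hn => ?_⟩
  have hp := fun x => pw_bound γ hγ (deriv m x) (m x) (hn x)
  refine ⟨hp, ?_⟩
  have hc : Continuous (deriv m) := hm.continuous_deriv le_rfl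
  have hmc : Continuous m := hm.continuous
  have hm1 : Continuous (fun x => m x 1) := by fun_prop
  have key : ENNReal.ofReal (1 - |γ|) * (eLpNorm (deriv m) 2 volume ^ 2
      + eLpNorm (fun x => m x 1) 2 volume ^ 2 + eLpNorm (fun x => m x 2) 2 volume ^ 2)
      ≤ ∫⁻ x : ℝ, ENNReal.ofReal
              (‖deriv m x‖ ^ 2 + 2 * γ * dot3 (deriv m x) (cross3 e1 (m x))
                + (1 - (m x 0) ^ 2)) := by
    simp only [eLpNorm_sq]
    have ha : Measurable fun x => ENNReal.ofReal (‖deriv m x‖ ^ 2) := by fun_prop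
    have hb : Measurable fun x => ENNReal.ofReal (‖m x 1‖ ^ 2) :=
      ENNReal.measurable_ofReal.comp (hm1.norm.pow 2).measurable
    have hab : Measurable fun x => ENNReal.ofReal (‖deriv m x‖ ^ 2)
        + ENNReal.ofReal (‖m x 1‖ ^ 2) := ha.add hb
    rw [← lintegral_add_left ha, ← lintegral_add_left hab,
      ← lintegral_const_mul' _ _ ENNReal.ofReal_ne_top]
    refine lintegral_mono fun x => ?_
    rw [← ENNReal.ofReal_add (by positivity) (by positivity),
      ← ENNReal.ofReal_add (by positivity) (by positivity), ← ENNReal.ofReal_mul hg.le]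
    refine ENNReal.ofReal_le_ofReal ?_
    simpa only [Real.norm_eq_abs, sq_abs] using hp x
  have hC : ENNReal.ofReal ((1 - |γ|) / 6) * 3 = 1 / 2 * ENNReal.ofReal (1 - |γ|) := by
    have h3 : (3 : ℝ≥0∞) = ENNReal.ofReal 3 := by simp
    have h2 : (1 / 2 : ℝ≥0∞) = ENNReal.ofReal (1 / 2) := by
      rw [ENNReal.ofReal_div_of_pos (by norm_num)]; simp
    rw [h3, h2, ← ENNReal.ofReal_mul (by positivity), ← ENNReal.ofReal_mul (by positivity)]
    congr 1
    ring
  refine (mul_le_mul_right (sq_sum_le _ _ _) _).trans ?_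
  rw [← mul_assoc, hC, mul_assoc]
  exact mul_le_mul_right key _
end
end

section
/- Let m, m̃ : ℝ → ℝ³ be continuously differentiable with |m(x)| = |m̃(x)| = 1 for all x, with finite ℋ¹ seminorms (i.e. m₂, m₃, m̃₂, m̃₃ ∈ L² and m′, m̃′ ∈ L²). Suppose m and m̃ have the same limits at infinity: lim_{x→+∞} m(x) = lim_{x→+∞} m̃(x) and lim_{x→−∞} m(x) = lim_{x→−∞} m̃(x) (these limits exist and belong to {±e₁}). Then m − m̃ ∈ L²(ℝ,ℝ³), and hence m − m̃ ∈ H¹(ℝ,ℝ³). -/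
open MeasureTheory Filter ENNReal

noncomputable section

lemma sph_sq (v : E3) (h : ‖v‖ = 1) : v 0 ^ 2 + v 1 ^ 2 + v 2 ^ 2 = 1 := by
  have h' := EuclideanSpace.norm_sq_eq v
  rw [h] at h'
  simp [Fin.sum_univ_three] at h'
  linarith

lemma lim_zero (f : ℝ → ℝ) (hf : MemLp f 2 volume) (l : Filter ℝ)
    (hl : ∀ s ∈ l, volume s = ⊤) (c : ℝ) (h : Tendsto f l (nhds c)) : c = 0 := by
  have h1 : Integrable (fun x => f x ^ 2) volume := hf.integrable_sq
  have h2 := IntegrableAtFilter.eq_zero_of_tendsto (h1.integrableAtFilter l) hl (h.pow 2)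
  simpa using h2

lemma key (m mt : ℝ → E3) (hsph : ∀ x, ‖m x‖ = 1) (htsph : ∀ x, ‖mt x‖ = 1)
    (h2 : MemLp (fun x => m x 1) 2 volume) (h3 : MemLp (fun x => m x 2) 2 volume)
    (l : Filter ℝ) [l.NeBot] (hl : ∀ s ∈ l, volume s = ⊤) (p : E3)
    (hm : Tendsto m l (nhds p)) (hmt : Tendsto mt l (nhds p)) :
    ∀ᶠ x in l, |m x 0 - mt x 0| ≤ |m x 1| + |m x 2| + |mt x 1| + |mt x 2| := by
  have hc : ∀ (i : Fin 3) (u : ℝ → E3), Tendsto u l (nhds p) →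
      Tendsto (fun x => u x i) l (nhds (p i)) := fun i u hu =>
    ((EuclideanSpace.proj (𝕜 := ℝ) i).continuous.tendsto p).comp hu
  have p1 := lim_zero _ h2 l hl _ (hc 1 m hm)
  have p2 := lim_zero _ h3 l hl _ (hc 2 m hm)
  have pn : ‖p‖ = 1 := by
    have := hm.norm
    simp only [hsph] at this
    exact (tendsto_nhds_unique this tendsto_const_nhds)
  have p0 := sph_sq p pn
  rw [p1, p2] at p0
  have hsum : Tendsto (fun x => |m x 0 + mt x 0|) l (nhds |p 0 + p 0|) :=
    ((hc 0 m hm).add (hc 0 mt hmt)).abs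
  have hp : 1 < |p 0 + p 0| := by
    rw [← one_lt_sq_iff₀ (abs_nonneg _), sq_abs]
    nlinarith
  filter_upwards [hsum.eventually (lt_mem_nhds hp)] with x hx
  have ha := sph_sq _ (hsph x)
  have hb := sph_sq _ (htsph x)
  have hs : ∀ t : ℝ, t ^ 2 ≤ 1 → t ^ 2 ≤ |t| := fun t ht => by
    have h1 : |t| ≤ 1 := by rwa [← sq_le_one_iff_abs_le_one]
    rw [← sq_abs]; nlinarith [abs_nonneg t]
  have e1 := hs (m x 1) (by nlinarith [sq_nonneg (m x 0), sq_nonneg (m x 2)])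
  have e2 := hs (m x 2) (by nlinarith [sq_nonneg (m x 0), sq_nonneg (m x 1)])
  have e3 := hs (mt x 1) (by nlinarith [sq_nonneg (mt x 0), sq_nonneg (mt x 2)])
  have e4 := hs (mt x 2) (by nlinarith [sq_nonneg (mt x 0), sq_nonneg (mt x 1)])
  have h5 : |m x 0 - mt x 0| ≤ |m x 0 - mt x 0| * |m x 0 + mt x 0| :=
    le_mul_of_one_le_right (abs_nonneg _) hx.le
  refine h5.trans ?_
  rw [← abs_mul, abs_le]
  constructor <;>
  nlinarith [sq_nonneg (m x 1), sq_nonneg (m x 2), sq_nonneg (mt x 1), sq_nonneg (mt x 2)]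

/-- two finite-ℋ¹ S²-valued maps with the same limits at ±∞ differ by an
    H¹ map. -/
theorem same_limits_H1 (m mt : ℝ → E3)
    (hreg : ContDiff ℝ 1 m) (htreg : ContDiff ℝ 1 mt)
    (hsph : ∀ x, ‖m x‖ = 1) (htsph : ∀ x, ‖mt x‖ = 1)
    (h2 : MemLp (fun x => m x 1) 2 volume) (h3 : MemLp (fun x => m x 2) 2 volume)
    (hd : MemLp (deriv m) 2 volume)
    (ht2 : MemLp (fun x => mt x 1) 2 volume) (ht3 : MemLp (fun x => mt x 2) 2 volume)
    (htd : MemLp (deriv mt) 2 volume)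
    (hlim : ∃ p q : E3,
      Tendsto m atTop (nhds p) ∧ Tendsto mt atTop (nhds p) ∧
      Tendsto m atBot (nhds q) ∧ Tendsto mt atBot (nhds q)) :
    MemLp (fun x => m x - mt x) 2 volume ∧
    MemLp (deriv (fun x => m x - mt x)) 2 volume := by
  obtain ⟨p, q, hp, htp, hq, htq⟩ := hlim
  have hT : ∀ s ∈ (atTop : Filter ℝ), volume s = ⊤ := fun s hs => by
    obtain ⟨a, ha⟩ := mem_atTop_sets.1 hs
    exact measure_mono_top (show Set.Ici a ⊆ s from ha) Real.volume_Ici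
  have hB : ∀ s ∈ (atBot : Filter ℝ), volume s = ⊤ := fun s hs => by
    obtain ⟨a, ha⟩ := mem_atBot_sets.1 hs
    exact measure_mono_top (show Set.Iic a ⊆ s from ha) Real.volume_Iic
  obtain ⟨R, hR⟩ := eventually_atTop.1 (key m mt hsph htsph h2 h3 atTop hT p hp htp)
  obtain ⟨S, hS⟩ := eventually_atBot.1 (key m mt hsph htsph h2 h3 atBot hB q hq htq)
  have hind : MemLp ((Set.Icc S R).indicator (fun _ => (2 : ℝ))) 2 volume :=
    memLp_indicator_const 2 measurableSet_Icc 2 (Or.inr (by simp))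
  have hco : ∀ u : ℝ → E3, ContDiff ℝ 1 u → ∀ i : Fin 3, Continuous (fun x => u x i) :=
    fun u hu i => (EuclideanSpace.proj (𝕜 := ℝ) i).continuous.comp hu.continuous
  have h0 : MemLp (fun x => m x 0 - mt x 0) 2 volume := by
    refine MemLp.mono' (g := fun x => (|m x 1| + |m x 2| + |mt x 1| + |mt x 2|) +
      (Set.Icc S R).indicator (fun _ => (2 : ℝ)) x) ?_
      ((hco m hreg 0).sub (hco mt htreg 0)).aestronglyMeasurable (ae_of_all _ fun x => ?_)
    · exact (((h2.abs.add h3.abs).add ht2.abs).add ht3.abs).add hind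
    · rw [Real.norm_eq_abs]
      have hi : 0 ≤ (Set.Icc S R).indicator (fun _ => (2 : ℝ)) x :=
        Set.indicator_nonneg (fun _ _ => by norm_num) x
      by_cases hxR : R ≤ x
      · linarith [hR x hxR]
      by_cases hxS : x ≤ S
      · linarith [hS x hxS]
      have hx : x ∈ Set.Icc S R := ⟨by linarith, by linarith⟩
      rw [Set.indicator_of_mem hx]
      have ha := sph_sq _ (hsph x)
      have hb := sph_sq _ (htsph x)
      have ha' : |m x 0| ≤ 1 := by
        rw [← sq_le_one_iff_abs_le_one]
        nlinarith [sq_nonneg (m x 1), sq_nonneg (m x 2)]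
      have hb' : |mt x 0| ≤ 1 := by
        rw [← sq_le_one_iff_abs_le_one]
        nlinarith [sq_nonneg (mt x 1), sq_nonneg (mt x 2)]
      linarith [abs_sub (m x 0) (mt x 0), abs_nonneg (m x 1), abs_nonneg (m x 2),
        abs_nonneg (mt x 1), abs_nonneg (mt x 2)]
  constructor
  · refine MemLp.mono' (g := fun x => |m x 0 - mt x 0| + |m x 1 - mt x 1| + |m x 2 - mt x 2|)
      ((h0.abs.add (h2.sub ht2).abs).add (h3.sub ht3).abs)
      (hreg.continuous.sub htreg.continuous).aestronglyMeasurable (ae_of_all _ fun x => ?_)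
    refine abs_le_of_sq_le_sq' ?_ (by positivity) |>.2
    rw [EuclideanSpace.norm_sq_eq]
    simp only [Fin.sum_univ_three, Real.norm_eq_abs, PiLp.sub_apply]
    nlinarith [mul_nonneg (abs_nonneg (m x 0 - mt x 0)) (abs_nonneg (m x 1 - mt x 1)),
      mul_nonneg (abs_nonneg (m x 0 - mt x 0)) (abs_nonneg (m x 2 - mt x 2)),
      mul_nonneg (abs_nonneg (m x 1 - mt x 1)) (abs_nonneg (m x 2 - mt x 2))]
  · have : deriv (fun x => m x - mt x) = fun x => deriv m x - deriv mt x := by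
      funext x
      exact deriv_fun_sub (hreg.differentiable (by norm_num) x)
        (htreg.differentiable (by norm_num) x)
    rw [this]
    exact hd.sub htd
end
end

section
/- Let m = (m₁,m₂,m₃) : ℝ → ℝ³ be continuously differentiable with |m(x)| = 1 for all x, with finite ℋ¹ seminorm, with m₁ not a constant function, and satisfying the nondegeneracy condition |m₁(x)| + |m₁′(x)| ≥ c for almost every x ∈ ℝ, for some constant c > 0. Then there exist δ > 0 and C > 0 (depending on m) such that for every continuously differentiable m̃ : ℝ → ℝ³ with |m̃(x)| = 1 for all x and ‖m − m̃‖_{ℋ¹} ≤ δ, one has m − m̃ ∈ L² and ‖m − m̃‖_{H¹} ≤ C·‖m − m̃‖_{ℋ¹}. -/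
open MeasureTheory Filter ENNReal

noncomputable section

lemma L2norm_nonneg' {E : Type*} [NormedAddCommGroup E] (u : ℝ → E) : 0 ≤ L2norm u :=
  ENNReal.toReal_nonneg

lemma L2norm_sq {E : Type*} [NormedAddCommGroup E] {u : ℝ → E} (hu : MemLp u 2 volume) :
    ∫ x, ‖u x‖ ^ 2 = L2norm u ^ 2 := by
  have h0 : 0 ≤ ∫ x, ‖u x‖ ^ 2 := integral_nonneg fun x => sq_nonneg _
  unfold L2norm
  rw [hu.eLpNorm_eq_integral_rpow_norm (by norm_num) (by norm_num)]
  have e : ∀ x, ‖u x‖ ^ (2 : ℝ≥0∞).toReal = ‖u x‖ ^ 2 := by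
    intro x; simp
  simp only [e]
  rw [ENNReal.toReal_ofReal (Real.rpow_nonneg h0 _), ← Real.rpow_natCast, ← Real.rpow_mul h0]
  simp

lemma L2norm_mono {E F : Type*} [NormedAddCommGroup E] [NormedAddCommGroup F]
    {u : ℝ → E} {v : ℝ → F} (hv : MemLp v 2 volume) (h : ∀ᵐ x, ‖u x‖ ≤ ‖v x‖) :
    L2norm u ≤ L2norm v :=
  ENNReal.toReal_mono hv.2.ne (eLpNorm_mono_ae h)

lemma L2norm_add_le {E : Type*} [NormedAddCommGroup E]
    {u v : ℝ → E} (hu : MemLp u 2 volume) (hv : MemLp v 2 volume) :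
    L2norm (fun x => u x + v x) ≤ L2norm u + L2norm v := by
  unfold L2norm
  rw [← ENNReal.toReal_add hu.2.ne hv.2.ne]
  exact ENNReal.toReal_mono (ENNReal.add_ne_top.2 ⟨hu.2.ne, hv.2.ne⟩)
    (eLpNorm_add_le hu.1 hv.1 (by norm_num))

lemma L2norm_const_mul (K : ℝ) (hK : 0 ≤ K) (u : ℝ → ℝ) :
    L2norm (fun x => K * u x) = K * L2norm u := by
  unfold L2norm
  have := eLpNorm_const_smul (μ := (volume : Measure ℝ)) (p := 2) K u
  have e : (fun x => K * u x) = K • u := rfl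
  rw [e, this, ENNReal.toReal_mul]
  simp [abs_of_nonneg hK]

lemma L2norm_norm {E : Type*} [NormedAddCommGroup E] (u : ℝ → E) :
    L2norm (fun x => ‖u x‖) = L2norm u := by
  unfold L2norm; rw [eLpNorm_norm]

lemma integrable_sq_deriv {g g' : ℝ → ℝ}
    (hg : MemLp g 2 volume) (hg' : MemLp g' 2 volume) :
    Integrable (fun x => 2 * g x * g' x) := by
  have := (hg.integrable_mul hg').const_mul 2
  refine this.congr (Eventually.of_forall fun x => ?_)
  simp only [Pi.mul_apply]; ring

lemma hasDerivAt_sq {g g' : ℝ → ℝ} (hd : ∀ x, HasDerivAt g (g' x) x) (x : ℝ) :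
    HasDerivAt (fun x => g x ^ 2) (2 * g x * g' x) x := by
  simpa using (hd x).fun_pow 2

lemma sq_tendsto_top {g g' : ℝ → ℝ} (hd : ∀ x, HasDerivAt g (g' x) x)
    (hg : MemLp g 2 volume) (hg' : MemLp g' 2 volume) :
    Tendsto (fun x => g x ^ 2) atTop (nhds 0) :=
  tendsto_zero_of_hasDerivAt_of_integrableOn_Ioi (a := 0)
    (fun x _ => hasDerivAt_sq hd x) (integrable_sq_deriv hg hg').integrableOn
    hg.integrable_sq.integrableOn

lemma sq_tendsto_bot {g g' : ℝ → ℝ} (hd : ∀ x, HasDerivAt g (g' x) x)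
    (hg : MemLp g 2 volume) (hg' : MemLp g' 2 volume) :
    Tendsto (fun x => g x ^ 2) atBot (nhds 0) :=
  tendsto_zero_of_hasDerivAt_of_integrableOn_Iic (a := 0)
    (fun x _ => hasDerivAt_sq hd x) (integrable_sq_deriv hg hg').integrableOn
    hg.integrable_sq.integrableOn

lemma sq_le_sobolev {g g' : ℝ → ℝ} (hd : ∀ x, HasDerivAt g (g' x) x)
    (hg : MemLp g 2 volume) (hg' : MemLp g' 2 volume) (x : ℝ) :
    g x ^ 2 ≤ L2norm g ^ 2 + L2norm g' ^ 2 := by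
  have h1 := integral_Iic_of_hasDerivAt_of_tendsto (a := x)
    (hasDerivAt_sq hd x).continuousAt.continuousWithinAt
    (fun x _ => hasDerivAt_sq hd x) (integrable_sq_deriv hg hg').integrableOn
    (sq_tendsto_bot hd hg hg')
  have hi : Integrable (fun x => g x ^ 2 + g' x ^ 2) := hg.integrable_sq.add hg'.integrable_sq
  have h2 : ∫ y in Set.Iic x, 2 * g y * g' y ≤ ∫ y in Set.Iic x, (g y ^ 2 + g' y ^ 2) := by
    apply integral_mono (integrable_sq_deriv hg hg').integrableOn hi.integrableOn
    intro y
    simp only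
    nlinarith [sq_nonneg (g y - g' y)]
  have h3 : ∫ y in Set.Iic x, (g y ^ 2 + g' y ^ 2) ≤ ∫ y, (g y ^ 2 + g' y ^ 2) :=
    setIntegral_le_integral hi (Eventually.of_forall fun y => by positivity)
  rw [integral_add hg.integrable_sq hg'.integrable_sq] at h3
  have e1 := L2norm_sq hg
  have e2 := L2norm_sq hg'
  simp only [Real.norm_eq_abs, sq_abs] at e1 e2
  linarith

lemma diff_le_aux {f f' : ℝ → ℝ} (hd : ∀ x, HasDerivAt f (f' x) x)
    (hf' : MemLp f' 2 volume) {δ : ℝ} (hδ : 0 < δ) (hfδ : L2norm f' ≤ δ) {x y : ℝ} (hxy : x ≤ y) :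
    |f y - f x| ≤ δ * (|y - x| + 1) := by
  have hi : Integrable (fun x => f' x ^ 2) := hf'.integrable_sq
  have hsq := L2norm_sq hf'
  simp only [Real.norm_eq_abs, sq_abs] at hsq
  have hii : IntegrableOn f' (Set.Ioc x y) :=
    (hf'.restrict (Set.Ioc x y)).integrable (by norm_num)
  have h1 := intervalIntegral.integral_eq_sub_of_hasDerivAt (a := x) (b := y)
    (fun z _ => hd z) ((intervalIntegrable_iff_integrableOn_Ioc_of_le hxy).2 hii)
  rw [← h1, intervalIntegral.integral_of_le hxy]
  have h2 : |∫ z in Set.Ioc x y, f' z| ≤ ∫ z in Set.Ioc x y, |f' z| :=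
    abs_integral_le_integral_abs
  have hic : IntegrableOn (fun _ : ℝ => δ) (Set.Ioc x y) := by simp
  have hiq : IntegrableOn (fun z : ℝ => f' z ^ 2 / δ) (Set.Ioc x y) :=
    (hi.div_const δ).integrableOn
  have h3 : ∫ z in Set.Ioc x y, |f' z| ≤ ∫ z in Set.Ioc x y, (δ + f' z ^ 2 / δ) := by
    apply integral_mono hii.abs (hic.add hiq)
    intro z
    have : δ + f' z ^ 2 / δ - |f' z| = ((δ - |f' z|) ^ 2 + δ * |f' z|) / δ := by
      field_simp; rw [← sq_abs (f' z)]; ring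
    have h' : 0 ≤ ((δ - |f' z|) ^ 2 + δ * |f' z|) / δ := by positivity
    show |f' z| ≤ δ + f' z ^ 2 / δ
    linarith
  rw [integral_add hic hiq] at h3
  have h4 : ∫ z in Set.Ioc x y, f' z ^ 2 / δ ≤ ∫ z, f' z ^ 2 / δ :=
    setIntegral_le_integral (hi.div_const δ) (Eventually.of_forall fun y => by positivity)
  have h4' : ∫ z, f' z ^ 2 / δ = L2norm f' ^ 2 / δ := by rw [integral_div, hsq]
  rw [h4'] at h4
  have h5 : L2norm f' ^ 2 / δ ≤ δ := by
    rw [div_le_iff₀ hδ]; nlinarith [L2norm_nonneg' f']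
  have h6 : ∫ z in Set.Ioc x y, δ = (y - x) * δ := by
    simp [hxy]
  rw [abs_of_nonneg (sub_nonneg.2 hxy)]
  linarith

lemma diff_le {f f' : ℝ → ℝ} (hd : ∀ x, HasDerivAt f (f' x) x)
    (hf' : MemLp f' 2 volume) {δ : ℝ} (hδ : 0 < δ) (hfδ : L2norm f' ≤ δ) (x y : ℝ) :
    |f y - f x| ≤ δ * (|y - x| + 1) := by
  rcases le_total x y with h | h
  · exact diff_le_aux hd hf' hδ hfδ h
  · rw [abs_sub_comm, abs_sub_comm y x]; exact diff_le_aux hd hf' hδ hfδ h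

lemma hasDerivAt_comp {m : ℝ → E3} (hm : ContDiff ℝ 1 m) (i : Fin 3) (x : ℝ) :
    HasDerivAt (fun x => m x i) (deriv m x i) x := by
  have h := (hm.differentiable (by norm_num) x).hasDerivAt
  exact (EuclideanSpace.proj (𝕜 := ℝ) i).hasFDerivAt.comp_hasDerivAt x h

lemma memLp_comp {g : ℝ → E3} (hg : MemLp g 2 volume) (i : Fin 3) :
    MemLp (fun x => g x i) 2 volume := by
  refine hg.of_le ((EuclideanSpace.proj (𝕜 := ℝ) i).continuous.comp_aestronglyMeasurable hg.1) ?_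
  exact Eventually.of_forall fun x => PiLp.norm_apply_le (g x) i

lemma L2norm_comp_le {g : ℝ → E3} (hg : MemLp g 2 volume) (i : Fin 3) :
    L2norm (fun x => g x i) ≤ L2norm g :=
  L2norm_mono hg (Eventually.of_forall fun x => PiLp.norm_apply_le (g x) i)

lemma sphere_eq {v : E3} (h : ‖v‖ = 1) : v 0 ^ 2 + v 1 ^ 2 + v 2 ^ 2 = 1 := by
  have := EuclideanSpace.norm_sq_eq v
  rw [h] at this
  simp [Fin.sum_univ_three] at this
  linarith

lemma norm_le_sum (v : E3) : ‖v‖ ≤ |v 0| + |v 1| + |v 2| := by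
  have := EuclideanSpace.norm_sq_eq v
  simp only [Fin.sum_univ_three, Real.norm_eq_abs] at this
  refine abs_le_of_sq_le_sq' ?_ (by positivity) |>.2
  rw [this]
  nlinarith [mul_nonneg (abs_nonneg (v 0)) (abs_nonneg (v 1)),
    mul_nonneg (abs_nonneg (v 0)) (abs_nonneg (v 2)),
    mul_nonneg (abs_nonneg (v 1)) (abs_nonneg (v 2))]

lemma exists_R {m : ℝ → E3}
    (hreg : ContDiff ℝ 1 m) (hsph : ∀ x, ‖m x‖ = 1)
    (h2 : MemLp (fun x => m x 1) 2 volume) (h3 : MemLp (fun x => m x 2) 2 volume)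
    (hd : MemLp (deriv m) 2 volume) (x0 : ℝ) :
    ∃ R : ℝ, 0 < R ∧ ∀ x, R < |x - x0| → 3 / 4 ≤ |m x 0| := by
  have t := (sq_tendsto_top (hasDerivAt_comp hreg 1) h2 (memLp_comp hd 1)).add
    (sq_tendsto_top (hasDerivAt_comp hreg 2) h3 (memLp_comp hd 2))
  have b := (sq_tendsto_bot (hasDerivAt_comp hreg 1) h2 (memLp_comp hd 1)).add
    (sq_tendsto_bot (hasDerivAt_comp hreg 2) h3 (memLp_comp hd 2))
  rw [add_zero] at t b
  have t' := t.eventually_lt_const (show (0:ℝ) < 1 / 4 by norm_num)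
  have b' := b.eventually_lt_const (show (0:ℝ) < 1 / 4 by norm_num)
  obtain ⟨A, hA⟩ := eventually_atTop.1 t'
  obtain ⟨B, hB⟩ := eventually_atBot.1 b'
  have key : ∀ x, m x 1 ^ 2 + m x 2 ^ 2 < 1 / 4 → 3 / 4 ≤ |m x 0| := by
    intro x hx
    have := sphere_eq (hsph x)
    refine (abs_le_of_sq_le_sq' ?_ (abs_nonneg _)).2
    rw [sq_abs]; linarith
  refine ⟨|A| + |B| + |x0| + 1, by positivity, fun x hx => ?_⟩
  have := le_abs_self A
  have := neg_abs_le B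
  have := le_abs_self x0
  have := neg_abs_le x0
  have := abs_nonneg A
  have := abs_nonneg B
  rcases le_total x0 x with h | h
  · rw [abs_of_nonneg (sub_nonneg.2 h)] at hx
    exact key x (hA x (by linarith))
  · rw [abs_of_nonpos (sub_nonpos.2 h)] at hx
    exact key x (hB x (by linarith))

lemma comp_abs_le_one {v : E3} (h : ‖v‖ = 1) (i : Fin 3) : |v i| ≤ 1 := by
  have := PiLp.norm_apply_le v i
  rw [h] at this
  simpa using this

/-- the algebraic identity coming from the sphere constraint -/
lemma prod_bound {a b : E3} (ha : ‖a‖ = 1) (hb : ‖b‖ = 1) :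
    |a 0 - b 0| * |2 * a 0 - (a 0 - b 0)| ≤ 2 * (|a 1 - b 1| + |a 2 - b 2|) := by
  have h1 := sphere_eq ha
  have h2 := sphere_eq hb
  rw [← abs_mul]
  have e : (a 0 - b 0) * (2 * a 0 - (a 0 - b 0))
      = -((a 1 - b 1) * (a 1 + b 1) + (a 2 - b 2) * (a 2 + b 2)) := by
    linear_combination h1 - h2
  rw [e, abs_neg]
  have k : ∀ i : Fin 3, |a i + b i| ≤ 2 := fun i => by
    have := abs_add_le (a i) (b i)
    linarith [comp_abs_le_one ha i, comp_abs_le_one hb i]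
  have := abs_add_le ((a 1 - b 1) * (a 1 + b 1)) ((a 2 - b 2) * (a 2 + b 2))
  rw [abs_mul, abs_mul] at this
  nlinarith [k 1, k 2, abs_nonneg (a 1 - b 1), abs_nonneg (a 2 - b 2)]

lemma sphere_deriv {m : ℝ → E3} (hreg : ContDiff ℝ 1 m) (hsph : ∀ x, ‖m x‖ = 1) (x : ℝ) :
    m x 0 * deriv m x 0 + m x 1 * deriv m x 1 + m x 2 * deriv m x 2 = 0 := by
  have h := ((hasDerivAt_sq (hasDerivAt_comp hreg 0) x).add
    (hasDerivAt_sq (hasDerivAt_comp hreg 1) x)).add (hasDerivAt_sq (hasDerivAt_comp hreg 2) x)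
  have e : (((fun x => m x 0 ^ 2) + fun x => m x 1 ^ 2) + fun x => m x 2 ^ 2)
      = fun _ : ℝ => (1 : ℝ) := by
    funext y
    exact sphere_eq (hsph y)
  rw [e] at h
  have := h.unique (hasDerivAt_const x (1 : ℝ))
  linarith

lemma deriv_bound {a b a' b' : E3} {h G N : ℝ} (hb : ‖b‖ = 1)
    (ea : a 0 * a' 0 + a 1 * a' 1 + a 2 * a' 2 = 0)
    (eb : b 0 * b' 0 + b 1 * b' 1 + b 2 * b' 2 = 0)
    (hh : 0 ≤ h)
    (h1 : |a 1 - b 1| ≤ 2 * h) (h2 : |a 2 - b 2| ≤ 2 * h)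
    (hG : ∀ i : Fin 3, |a' i - b' i| ≤ G) (hN : ∀ i : Fin 3, |a' i| ≤ N) :
    |a 0 - b 0| * |a' 0| ≤ 3 * G + 4 * h * N := by
  rw [← abs_mul]
  have e : (a 0 - b 0) * a' 0 = -(b 0 * (a' 0 - b' 0)) - b 1 * (a' 1 - b' 1)
      - b 2 * (a' 2 - b' 2) - (a 1 - b 1) * a' 1 - (a 2 - b 2) * a' 2 := by
    linear_combination ea - eb
  have hG0 : 0 ≤ G := (abs_nonneg _).trans (hG 0)
  have k : ∀ i : Fin 3, |b i * (a' i - b' i)| ≤ G := fun i => by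
    rw [abs_mul]
    calc |b i| * |a' i - b' i| ≤ 1 * G :=
          mul_le_mul (comp_abs_le_one hb i) (hG i) (abs_nonneg _) zero_le_one
      _ = G := one_mul G
  have k1 : |(a 1 - b 1) * a' 1| ≤ 2 * h * N := by
    rw [abs_mul]; exact mul_le_mul h1 (hN 1) (abs_nonneg _) (by positivity)
  have k2 : |(a 2 - b 2) * a' 2| ≤ 2 * h * N := by
    rw [abs_mul]; exact mul_le_mul h2 (hN 2) (abs_nonneg _) (by positivity)
  have l0 := abs_le.1 (k 0)
  have l1 := abs_le.1 (k 1)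
  have l2 := abs_le.1 (k 2)
  have l3 := abs_le.1 k1
  have l4 := abs_le.1 k2
  rw [e, abs_le]
  constructor <;> linarith [l0.1, l0.2, l1.1, l1.2, l2.1, l2.2, l3.1, l3.2, l4.1, l4.2]

/-- two-point argument -/
lemma two_point {a b k k1 δ D : ℝ} (hk : |k| ≤ 2) (hk1 : |k1| ≤ 2) (hb : |b| ≤ 1)
    (h0 : |k| * |2 * a - k| ≤ 8 * δ) (h1 : |k1| * |2 * b - k1| ≤ 8 * δ)
    (hD : |k1 - k| ≤ D) : 2 * |k| * |a - b| ≤ 16 * δ + 8 * D := by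
  rw [← abs_mul] at h0 h1
  have e : 2 * (k * (a - b)) = k * (2 * a - k) - k1 * (2 * b - k1)
      + (k1 - k) * (2 * b - k1 - k) := by ring
  have hs : |2 * b - k1 - k| ≤ 8 := by
    rw [abs_le] at *; constructor <;> linarith
  have h3 : |(k1 - k) * (2 * b - k1 - k)| ≤ D * 8 := by
    rw [abs_mul]
    exact mul_le_mul hD hs (abs_nonneg _) ((abs_nonneg _).trans hD)
  have : |2 * (k * (a - b))| ≤ 16 * δ + 8 * D := by
    rw [e, abs_le]
    rw [abs_le] at h0 h1 h3
    constructor <;> linarith [h0.1, h0.2, h1.1, h1.2, h3.1, h3.2]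
  rwa [abs_mul, abs_mul, abs_two, ← mul_assoc] at this

/-- under the nondegeneracy condition |m₁| + |m₁′| ≥ c a.e., the H¹ norm
    of the difference is linearly controlled by the ℋ¹ seminorm. -/
theorem nondegenerate_H1_bound (m : ℝ → E3)
    (hreg : ContDiff ℝ 1 m) (hsph : ∀ x, ‖m x‖ = 1)
    (h2 : MemLp (fun x => m x 1) 2 volume) (h3 : MemLp (fun x => m x 2) 2 volume)
    (hd : MemLp (deriv m) 2 volume)
    (hnc : ¬ ∃ c : ℝ, ∀ x : ℝ, m x 0 = c)
    (c : ℝ) (hc : 0 < c)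
    (hnd : ∀ᵐ x : ℝ ∂volume, c ≤ |m x 0| + |deriv m x 0|) :
    ∃ δ C : ℝ, 0 < δ ∧ 0 < C ∧
      ∀ mt : ℝ → E3, ContDiff ℝ 1 mt → (∀ x, ‖mt x‖ = 1) →
      MemLp (fun x => m x 1 - mt x 1) 2 volume →
      MemLp (fun x => m x 2 - mt x 2) 2 volume →
      MemLp (deriv (fun x => m x - mt x)) 2 volume →
      HH1 (fun x => m x - mt x) ≤ δ →
      MemLp (fun x => m x - mt x) 2 volume ∧
      H1norm (fun x => m x - mt x) ≤ C * HH1 (fun x => m x - mt x) := by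
  push Not at hnc
  obtain ⟨x1, hx1⟩ := hnc (m 0 0)
  obtain ⟨R, hR, hRm⟩ := exists_R hreg hsph h2 h3 hd 0
  have hab : 0 < |m 0 0 - m x1 0| := abs_pos.2 (sub_ne_zero.2 hx1.symm)
  obtain ⟨M, hM⟩ : ∃ M : ℝ, M = (16 + 8 * (|x1 - 0| + 1)) / (2 * |m 0 0 - m x1 0|) + (R + 1) :=
    ⟨_, rfl⟩
  have hMpos : 0 < M := by rw [hM]; positivity
  obtain ⟨η, hηdef⟩ : ∃ η : ℝ, η = min (c / 2) (1 / 4) := ⟨_, rfl⟩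
  have hη : 0 < η := by rw [hηdef]; positivity
  have hηc : η ≤ c / 2 := by rw [hηdef]; exact min_le_left _ _
  have hη4 : η ≤ 1 / 4 := by rw [hηdef]; exact min_le_right _ _
  obtain ⟨δ, hδdef⟩ : ∃ δ : ℝ, δ = η / (M + 9) := ⟨_, rfl⟩
  have hδ : 0 < δ := by rw [hδdef]; positivity
  have hδe : δ * M + 9 * δ = η := by rw [hδdef]; field_simp
  have hN0 := L2norm_nonneg' (deriv m)
  refine ⟨δ, (8 / c + 1) * (1 + L2norm (deriv m)) + 1, hδ, by positivity, ?_⟩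
  intro mt hregt hspht hg2 hg3 hgd hle
  have hregg : ContDiff ℝ 1 (fun x => m x - mt x) := hreg.sub hregt
  have hderiv : ∀ x, deriv (fun x => m x - mt x) x = deriv m x - deriv mt x := fun x =>
    deriv_fun_sub (hreg.differentiable (by norm_num) x) (hregt.differentiable (by norm_num) x)
  obtain ⟨h, hh⟩ : ∃ h : ℝ, h = HH1 (fun x => m x - mt x) := ⟨_, rfl⟩
  rw [← hh] at hle ⊢
  have n1 := L2norm_nonneg' (fun x => m x 1 - mt x 1)
  have n2 := L2norm_nonneg' (fun x => m x 2 - mt x 2)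
  have n3 := L2norm_nonneg' (deriv (fun x => m x - mt x))
  have hhe : h = L2norm (fun x => m x 1 - mt x 1) + L2norm (fun x => m x 2 - mt x 2)
      + L2norm (deriv (fun x => m x - mt x)) := hh
  have hh0 : 0 ≤ h := by rw [hhe]; positivity
  -- sup bounds
  have sup : ∀ i : Fin 3, MemLp (fun x => m x i - mt x i) 2 volume →
      L2norm (fun x => m x i - mt x i) ≤ h → ∀ x, |m x i - mt x i| ≤ 2 * h := by
    intro i hi hl x
    have s := sq_le_sobolev (hasDerivAt_comp hregg i) hi (memLp_comp hgd i) x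
    have t := L2norm_comp_le hgd i
    have t0 := L2norm_nonneg' (fun x => deriv (fun x => m x - mt x) x i)
    have l0 := L2norm_nonneg' (fun x => m x i - mt x i)
    have s' : (m x i - mt x i) ^ 2 ≤ L2norm (fun x => m x i - mt x i) ^ 2
      + L2norm (fun x => deriv (fun x => m x - mt x) x i) ^ 2 := s
    apply abs_le_of_sq_le_sq _ (by positivity)
    have q1 := pow_le_pow_left₀ l0 hl 2
    have q2 := pow_le_pow_left₀ t0 (t.trans (show _ ≤ h by linarith)) 2
    nlinarith [sq_nonneg h]
  have sup1 := sup 1 hg2 (by linarith)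
  have sup2 := sup 2 hg3 (by linarith)
  have hp : ∀ x, |m x 0 - mt x 0| * |2 * m x 0 - (m x 0 - mt x 0)| ≤ 8 * δ := fun x => by
    have := prod_bound (hsph x) (hspht x)
    linarith [sup1 x, sup2 x]
  have hf2 : ∀ x, |m x 0 - mt x 0| ≤ 2 := fun x => by
    have := abs_sub (m x 0) (mt x 0)
    linarith [comp_abs_le_one (hsph x) 0, comp_abs_le_one (hspht x) 0]
  have hdiff : ∀ x y, |(m y 0 - mt y 0) - (m x 0 - mt x 0)| ≤ δ * (|y - x| + 1) := fun x y =>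
    diff_le (hasDerivAt_comp hregg 0) (memLp_comp hgd 0) hδ
      ((L2norm_comp_le hgd 0).trans (by linarith)) x y
  have hk : |m 0 0 - mt 0 0| ≤ δ * ((16 + 8 * (|x1 - 0| + 1)) / (2 * |m 0 0 - m x1 0|)) := by
    have := two_point (hf2 0) (hf2 x1) (comp_abs_le_one (hsph x1) 0) (hp 0) (hp x1) (hdiff 0 x1)
    rw [mul_div_assoc', le_div_iff₀ (by positivity)]
    linarith
  have hlocal : ∀ x, |x - 0| ≤ R → |m x 0 - mt x 0| < η := fun x hx => by
    have a1 := hdiff 0 x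
    have a2 : |m x 0 - mt x 0| ≤ |(m x 0 - mt x 0) - (m 0 0 - mt 0 0)| + |m 0 0 - mt 0 0| := by
      have := abs_add_le ((m x 0 - mt x 0) - (m 0 0 - mt 0 0)) (m 0 0 - mt 0 0)
      simpa using this
    have a3 : δ * (|x - 0| + 1) ≤ δ * (R + 1) := by gcongr
    have a4 : δ * M = δ * ((16 + 8 * (|x1 - 0| + 1)) / (2 * |m 0 0 - m x1 0|)) + δ * (R + 1) := by
      rw [hM]; ring
    linarith
  have hne : ∀ y, |m y 0 - mt y 0| ≠ η := by
    intro y hy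
    by_cases hyR : |y - 0| ≤ R
    · exact (hlocal y hyR).ne hy
    · have u := hRm y (not_le.1 hyR)
      have p := hp y
      have s : 1 ≤ |2 * m y 0 - (m y 0 - mt y 0)| := by
        have := abs_sub_abs_le_abs_sub (2 * m y 0) (m y 0 - mt y 0)
        rw [abs_mul, abs_two, hy] at this
        linarith
      rw [hy] at p
      have hδM : 0 < δ * M := by positivity
      nlinarith
  have hcont : Continuous (fun x => |m x 0 - mt x 0|) := by
    have : Continuous (fun x => m x 0 - mt x 0) :=
      continuous_iff_continuousAt.2 fun x => (hasDerivAt_comp hregg 0 x).continuousAt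
    exact this.abs
  have hglob : ∀ x, |m x 0 - mt x 0| < η := by
    intro x
    by_contra hx
    obtain ⟨y, hy⟩ := mem_range_of_exists_le_of_exists_ge hcont
      ⟨0, (hlocal 0 (by simpa using hR.le)).le⟩ ⟨x, not_lt.1 hx⟩
    exact hne y hy
  -- pointwise bound
  have hpt : ∀ᵐ x : ℝ, ‖m x - mt x‖ ≤ (8 / c + 1) * (|m x 1 - mt x 1| + |m x 2 - mt x 2|
      + ‖deriv (fun x => m x - mt x) x‖ + h * ‖deriv m x‖) := by
    filter_upwards [hnd] with x hx
    have g1 := abs_nonneg (m x 1 - mt x 1)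
    have g2 := abs_nonneg (m x 2 - mt x 2)
    have g3 := norm_nonneg (deriv (fun x => m x - mt x) x)
    have g4 : 0 ≤ h * ‖deriv m x‖ := by positivity
    have f0 := abs_nonneg (m x 0 - mt x 0)
    have main : |m x 0 - mt x 0| * (c / 2) ≤ 4 * (|m x 1 - mt x 1| + |m x 2 - mt x 2|
      + ‖deriv (fun x => m x - mt x) x‖ + h * ‖deriv m x‖) := by
      by_cases hu : c / 2 ≤ |m x 0|
      · have p := prod_bound (hsph x) (hspht x)
        have s : c / 2 ≤ |2 * m x 0 - (m x 0 - mt x 0)| := by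
          have := abs_sub_abs_le_abs_sub (2 * m x 0) (m x 0 - mt x 0)
          rw [abs_mul, abs_two] at this
          linarith [hglob x]
        have := mul_le_mul_of_nonneg_left s f0
        linarith
      · have hu' : c / 2 ≤ |deriv m x 0| := by linarith
        have := deriv_bound (hspht x) (sphere_deriv hreg hsph x) (sphere_deriv hregt hspht x) hh0
          (sup1 x) (sup2 x) (G := ‖deriv (fun x => m x - mt x) x‖) (N := ‖deriv m x‖)
          (fun i => by
            have := PiLp.norm_apply_le (deriv (fun x => m x - mt x) x) i
            rw [hderiv] at this ⊢
            exact this)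
          (fun i => PiLp.norm_apply_le (deriv m x) i)
        have := mul_le_mul_of_nonneg_left hu' f0
        linarith
    have main' : |m x 0 - mt x 0| ≤ (8 / c) * (|m x 1 - mt x 1| + |m x 2 - mt x 2|
      + ‖deriv (fun x => m x - mt x) x‖ + h * ‖deriv m x‖) := by
      rw [div_mul_eq_mul_div, le_div_iff₀ hc]
      linarith
    have nn : ‖m x - mt x‖ ≤ |m x 0 - mt x 0| + |m x 1 - mt x 1| + |m x 2 - mt x 2| :=
      norm_le_sum (m x - mt x)
    linarith
  have q1 : MemLp (fun x => |m x 1 - mt x 1|) 2 volume := hg2.norm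
  have q2 : MemLp (fun x => |m x 2 - mt x 2|) 2 volume := hg3.norm
  have q3 : MemLp (fun x => ‖deriv (fun x => m x - mt x) x‖) 2 volume := hgd.norm
  have q4 : MemLp (fun x => h * ‖deriv m x‖) 2 volume := hd.norm.const_mul h
  have q12 : MemLp (fun x => |m x 1 - mt x 1| + |m x 2 - mt x 2|) 2 volume := q1.add q2
  have q123 : MemLp (fun x => |m x 1 - mt x 1| + |m x 2 - mt x 2|
      + ‖deriv (fun x => m x - mt x) x‖) 2 volume := q12.add q3
  have q : MemLp (fun x => |m x 1 - mt x 1| + |m x 2 - mt x 2|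
      + ‖deriv (fun x => m x - mt x) x‖ + h * ‖deriv m x‖) 2 volume := q123.add q4
  have b1 := L2norm_add_le q123 q4
  have b2 := L2norm_add_le q12 q3
  have b3 := L2norm_add_le q1 q2
  rw [L2norm_const_mul h hh0 (fun x => ‖deriv m x‖), L2norm_norm (deriv m)] at b1
  rw [L2norm_norm (deriv (fun x => m x - mt x))] at b2
  have c1 : L2norm (fun x => |m x 1 - mt x 1|) = L2norm (fun x => m x 1 - mt x 1) :=
    L2norm_norm (fun x => m x 1 - mt x 1)
  have c2 : L2norm (fun x => |m x 2 - mt x 2|) = L2norm (fun x => m x 2 - mt x 2) :=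
    L2norm_norm (fun x => m x 2 - mt x 2)
  rw [c1, c2] at b3
  have hK : 0 ≤ 8 / c + 1 := by positivity
  have qK := q.const_mul (8 / c + 1)
  have hpt' := hpt.mono fun x hx => hx.trans (le_abs_self _)
  have bound := L2norm_mono qK hpt'
  rw [L2norm_const_mul _ hK] at bound
  refine ⟨qK.of_le hregg.continuous.aestronglyMeasurable hpt', ?_⟩
  have b4 : L2norm (fun x => |m x 1 - mt x 1| + |m x 2 - mt x 2|
      + ‖deriv (fun x => m x - mt x) x‖ + h * ‖deriv m x‖) ≤ h * (1 + L2norm (deriv m)) := by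
    linarith
  have fin := bound.trans (mul_le_mul_of_nonneg_left b4 hK)
  unfold H1norm
  have e : ((8 / c + 1) * (1 + L2norm (deriv m)) + 1) * h
      = (8 / c + 1) * (h * (1 + L2norm (deriv m))) + h := by ring
  rw [e]
  linarith
end
end
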